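/- arXiv:2506.24116 — 10 statements merged into one kernel-verified Lean document; each statement's English description precedes it below -/
import Mathlib

section
/- For every natural number d ≥ 2, the polynomial function f_d : ℝ^d → ℝ defined by f_d(x_1,…,x_d) = ∏_{1 ≤ i < j ≤ d} (x_i² − x_j²) is harmonic on all of ℝ^d, i.e. Σ_{k=1}^d ∂²f_d/∂x_k²(x) = 0 for every x ∈ ℝ^d. -/
/-- The second partial derivative of `f : ℝ^d → ℝ` in the `k`-th coordinate direction. -/
noncomputable def secondPartial {d : ℕ} (f : (Fin d → ℝ) → ℝ) (k : Fin d)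
    (x : Fin d → ℝ) : ℝ :=
  fderiv ℝ (fun y => fderiv ℝ f y (Pi.single k 1)) x (Pi.single k 1)

/-- A function `f : ℝ^d → ℝ` is harmonic on all of `ℝ^d` if it is smooth and its
Laplacian `Σ_{k=1}^d ∂²f/∂x_k²` vanishes identically. -/
def IsHarmonic {d : ℕ} (f : (Fin d → ℝ) → ℝ) : Prop :=
  ContDiff ℝ (⊤ : ℕ∞) f ∧ ∀ x, ∑ k, secondPartial f k x = 0

open Polynomial

/-- The matrix whose entry in row `i` and column `j` is the value at `x i` of the
polynomial `P j`. -/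
noncomputable def evalMatrix {d : ℕ} (P : Fin d → ℝ[X]) (x : Fin d → ℝ) :
    Matrix (Fin d) (Fin d) ℝ :=
  Matrix.of fun i j => (P j).eval (x i)

theorem Matrix.det_updateRow_eq_sum_adjugate {n R : Type*} [Fintype n] [DecidableEq n]
    [CommRing R] (A : Matrix n n R) (k : n) (b : n → R) :
    (A.updateRow k b).det = ∑ j, A.adjugate j k * b j := by
  rw [← Matrix.cramer_transpose_apply, Matrix.cramer_eq_adjugate_mulVec,
    ← Matrix.adjugate_transpose]
  rfl

theorem contDiff_det_updateRow_evalMatrix {d : ℕ} (P Q : Fin d → ℝ[X]) (k : Fin d)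
    {n : WithTop ℕ∞} :
    ContDiff ℝ n fun x : Fin d → ℝ =>
      ((evalMatrix P x).updateRow k fun j => (Q j).eval (x k)).det := by
  simp only [Matrix.det_apply]
  refine ContDiff.sum fun σ _ => ContDiff.const_smul _ (contDiff_prod fun i _ => ?_)
  by_cases h : σ i = k
  · simp only [h, Matrix.updateRow_self, ← Polynomial.coe_aeval_eq_eval]
    exact (Polynomial.contDiff_aeval (Q i) n).comp (contDiff_apply ℝ ℝ k)
  · simp only [Matrix.updateRow_ne h, evalMatrix, Matrix.of_apply,
      ← Polynomial.coe_aeval_eq_eval]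
    exact (Polynomial.contDiff_aeval (P i) n).comp (contDiff_apply ℝ ℝ (σ i))

/-- Differentiating in the `k`-th coordinate differentiates the `k`-th row. -/
theorem fderiv_det_updateRow_evalMatrix {d : ℕ} (P Q : Fin d → ℝ[X]) (k : Fin d)
    (x : Fin d → ℝ) :
    fderiv ℝ (fun y : Fin d → ℝ =>
        ((evalMatrix P y).updateRow k fun j => (Q j).eval (y k)).det) x (Pi.single k 1) =
      ((evalMatrix P x).updateRow k fun j => (derivative (Q j)).eval (x k)).det := by
  rw [← ((contDiff_det_updateRow_evalMatrix P Q k (n := 1)).differentiable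
    one_ne_zero x).lineDeriv_eq_fderiv]
  apply HasLineDerivAt.lineDeriv
  have hline (t : ℝ) :
      ((evalMatrix P (x + t • Pi.single k 1)).updateRow k
        fun j => (Q j).eval ((x + t • Pi.single k 1 : Fin d → ℝ) k)).det =
      ∑ j, (evalMatrix P x).adjugate j k * (Q j).eval (x k + t) := by
    rw [← Matrix.det_updateRow_eq_sum_adjugate]
    congr 1
    ext i j
    by_cases h : i = k
    · subst h
      simp
    · simp [evalMatrix, h]
  simp only [HasLineDerivAt, hline]
  rw [Matrix.det_updateRow_eq_sum_adjugate]
  refine HasDerivAt.fun_sum fun j _ => HasDerivAt.const_mul _ ?_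
  simpa using HasDerivAt.comp_const_add (x k) 0 ((Q j).hasDerivAt (x k + 0))

theorem secondPartial_det_evalMatrix {d : ℕ} (P : Fin d → ℝ[X]) (k : Fin d)
    (x : Fin d → ℝ) :
    secondPartial (fun y => (evalMatrix P y).det) k x =
      ((evalMatrix P x).updateRow k
        fun j => (derivative (derivative (P j))).eval (x k)).det := by
  have h (y : Fin d → ℝ) :
      (evalMatrix P y).det =
        ((evalMatrix P y).updateRow k fun j => (P j).eval (y k)).det := by
    congr 1
    exact (Matrix.updateRow_eq_self _ k).symm
  simp only [secondPartial, h, fderiv_det_updateRow_evalMatrix]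

/-- If the second derivative acts on the family `P` through a matrix of trace zero, then
`det (P j (x i))` is harmonic. -/
theorem isHarmonic_det_evalMatrix {d : ℕ} (P : Fin d → ℝ[X]) (N : Matrix (Fin d) (Fin d) ℝ)
    (hN : N.trace = 0)
    (hP : ∀ j, derivative (derivative (P j)) = ∑ l, P l * C (N l j)) :
    IsHarmonic fun x => (evalMatrix P x).det := by
  refine ⟨?_, fun x => ?_⟩
  · simp only [Matrix.det_apply, evalMatrix, Matrix.of_apply, ← Polynomial.coe_aeval_eq_eval]
    exact ContDiff.sum fun σ _ => ContDiff.const_smul _ (contDiff_prod fun i _ =>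
      (Polynomial.contDiff_aeval (P i) _).comp (contDiff_apply ℝ ℝ (σ i)))
  · have h : ∀ k j, (derivative (derivative (P j))).eval (x k) = (evalMatrix P x * N) k j := by
      intro k j
      simp [hP, Matrix.mul_apply, evalMatrix, eval_finsetSum]
    calc
      ∑ k, secondPartial (fun y => (evalMatrix P y).det) k x
        = ∑ k, ∑ j, (evalMatrix P x).adjugate j k * (evalMatrix P x * N) k j := by
          simp only [secondPartial_det_evalMatrix, Matrix.det_updateRow_eq_sum_adjugate, h]
      _ = ((evalMatrix P x).adjugate * (evalMatrix P x * N)).trace := by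
          rw [Finset.sum_comm]
          simp [Matrix.trace, Matrix.mul_apply]
      _ = 0 := by
          rw [← Matrix.mul_assoc, Matrix.adjugate_mul, Matrix.smul_mul, Matrix.one_mul,
            Matrix.trace_smul, hN, smul_zero]

theorem derivative_derivative_neg_X_sq_pow_succ (n : ℕ) :
    derivative (derivative ((-X ^ 2 : ℝ[X]) ^ (n + 1))) =
      (-X ^ 2) ^ n * C (-(2 * (n + 1) * (2 * n + 1) : ℝ)) := by
  have h (m : ℕ) : (-X ^ 2 : ℝ[X]) ^ m = C ((-1) ^ m) * X ^ (2 * m) := by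
    rw [neg_pow, ← pow_mul]
    simp
  rw [h, h, show 2 * (n + 1) = 2 * n + 1 + 1 by ring]
  simp only [derivative_C_mul, derivative_X_pow, Nat.add_sub_cancel]
  simp [show (C 2 : ℝ[X]) = 2 from rfl]
  ring

/-- For every `d ≥ 2`, the function `f_d(x) = ∏_{1 ≤ i < j ≤ d} (x_i² − x_j²)`
is harmonic on all of `ℝ^d`. -/
theorem vandermonde_of_squares_harmonic (d : ℕ) (hd : 2 ≤ d) :
    IsHarmonic (fun x : Fin d → ℝ =>
      ∏ i : Fin d, ∏ j ∈ Finset.Ioi i, (x i ^ 2 - x j ^ 2)) := by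
  have hdet : (fun x : Fin d → ℝ => ∏ i : Fin d, ∏ j ∈ Finset.Ioi i, (x i ^ 2 - x j ^ 2)) =
      fun x => (evalMatrix (fun j : Fin d => (-X ^ 2 : ℝ[X]) ^ (j : ℕ)) x).det := by
    ext x
    have hM : evalMatrix (fun j : Fin d => (-X ^ 2 : ℝ[X]) ^ (j : ℕ)) x =
        Matrix.vandermonde fun i => -x i ^ 2 := by
      ext i j
      simp [evalMatrix, Matrix.vandermonde_apply]
    rw [hM, Matrix.det_vandermonde]
    refine Finset.prod_congr rfl fun i _ => Finset.prod_congr rfl fun j _ => ?_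
    ring
  rw [hdet]
  refine isHarmonic_det_evalMatrix _
    (Matrix.of fun l j : Fin d => if (l : ℕ) + 1 = j then
      -(2 * ((l : ℝ) + 1) * (2 * (l : ℝ) + 1)) else 0) (by simp [Matrix.trace]) ?_
  rintro ⟨_ | n, hj⟩
  · simp
  · rw [derivative_derivative_neg_X_sq_pow_succ,
      Finset.sum_eq_single_of_mem (⟨n, by omega⟩ : Fin d) (Finset.mem_univ _)]
    · simp
    · intro l _ hl
      have : (l : ℕ) ≠ n := fun h => hl (Fin.ext h)
      simp [this]
end

section
/- For every natural number d ≥ 3, there exists a function f : ℝ^d → ℝ that is harmonic on all of ℝ^d, not identically zero, and vanishes at every point of the (d−2)-skeleton S_{d−2,d} of the unit cube Q_d = [−1/2, 1/2]^d. -/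
theorem prod_update_apply_eq_mul_prod_erase {ι : Type*} [Fintype ι] [DecidableEq ι]
    (u : ι → ℝ → ℝ) (k : ι) (v : ℝ → ℝ) (x : ι → ℝ) :
    ∏ i, Function.update u k v i (x i) = v (x k) * ∏ i ∈ Finset.univ.erase k, u i (x i) := by
  rw [← Finset.mul_prod_erase _ _ (Finset.mem_univ k), Function.update_self]
  congr 1
  exact Finset.prod_congr rfl fun i hi => by
    rw [Function.update_of_ne (Finset.ne_of_mem_erase hi)]

/-- The partial derivative of a separable product `∏ i, u i (x i)` in the `k`-th direction is
obtained by differentiating the `k`-th factor. -/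
theorem fderiv_prod_apply_single {d : ℕ} {u : Fin d → ℝ → ℝ} (hu : ∀ i, Differentiable ℝ (u i))
    (k : Fin d) (x : Fin d → ℝ) :
    fderiv ℝ (fun y : Fin d → ℝ => ∏ i, u i (y i)) x (Pi.single k 1) =
      ∏ i, Function.update u k (deriv (u k)) i (x i) := by
  have h : ∀ i ∈ Finset.univ, HasFDerivAt (fun y : Fin d → ℝ => u i (y i))
      (deriv (u i) (x i) • ContinuousLinearMap.proj (R := ℝ) (φ := fun _ : Fin d => ℝ) i) x :=
    fun i _ => (hu i (x i)).hasDerivAt.comp_hasFDerivAt x (hasFDerivAt_apply i x)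
  rw [(HasFDerivAt.finsetProd h).fderiv, prod_update_apply_eq_mul_prod_erase]
  simp [Pi.single_apply, mul_comm]

/-- A product of solutions of `u i'' = c i * u i` is harmonic as soon as `∑ i, c i = 0`. -/
theorem isHarmonic_prod {d : ℕ} {u : Fin d → ℝ → ℝ} {c : Fin d → ℝ}
    (hu : ∀ i, ContDiff ℝ (⊤ : ℕ∞) (u i))
    (hc : ∀ i t, deriv (deriv (u i)) t = c i * u i t) (hsum : ∑ i, c i = 0) :
    IsHarmonic fun x : Fin d → ℝ => ∏ i, u i (x i) := by
  refine ⟨contDiff_prod fun i _ => (hu i).comp (contDiff_apply ℝ ℝ i), fun x => ?_⟩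
  have hd : ∀ i, Differentiable ℝ (u i) := fun i => (hu i).differentiable (by simp)
  have key : ∀ k, secondPartial (fun x : Fin d → ℝ => ∏ i, u i (x i)) k x =
      c k * ∏ i, u i (x i) := by
    intro k
    have hd' : ∀ i, Differentiable ℝ (Function.update u k (deriv (u k)) i) := by
      intro i
      rcases eq_or_ne i k with rfl | hik
      · rw [Function.update_self]
        exact ((contDiff_infty_iff_deriv.1 (hu i)).2).differentiable (by simp)
      · rw [Function.update_of_ne hik]
        exact hd i
    unfold secondPartial
    simp_rw [fderiv_prod_apply_single hd k]
    rw [fderiv_prod_apply_single hd' k, Function.update_idem, Function.update_self,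
      prod_update_apply_eq_mul_prod_erase, hc, mul_assoc,
      Finset.mul_prod_erase _ (fun i => u i (x i)) (Finset.mem_univ k)]
  simp_rw [key, ← Finset.sum_mul, hsum, zero_mul]

theorem deriv_deriv_cos_const_mul (a t : ℝ) :
    deriv (deriv fun s => Real.cos (a * s)) t = -a ^ 2 * Real.cos (a * t) := by
  have h (s : ℝ) : HasDerivAt (fun s => a * s) a s := by
    simpa using (hasDerivAt_id s).const_mul a
  rw [funext fun s => ((h s).cos).deriv, (((h t).sin.fun_neg).mul_const a).deriv]
  ring

theorem deriv_deriv_cosh_const_mul (a t : ℝ) :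
    deriv (deriv fun s => Real.cosh (a * s)) t = a ^ 2 * Real.cosh (a * t) := by
  have h (s : ℝ) : HasDerivAt (fun s => a * s) a s := by
    simpa using (hasDerivAt_id s).const_mul a
  rw [funext fun s => ((h s).cosh).deriv, ((h t).sinh.mul_const a).deriv]
  ring

/-- For every `d ≥ 3` there is a nonzero entire harmonic function on `ℝ^d` vanishing
on the `(d−2)`-skeleton of the unit cube `Q_d = [−1/2, 1/2]^d`, i.e. at every point
of `Q_d` having at least two coordinates in `{−1/2, 1/2}`. -/
theorem exists_harmonic_vanishing_on_cube_skeleton (d : ℕ) (hd : 3 ≤ d) :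
    ∃ f : (Fin d → ℝ) → ℝ, IsHarmonic f ∧ f ≠ 0 ∧
      ∀ x : Fin d → ℝ, (∀ i, x i ∈ Set.Icc (-(1/2) : ℝ) (1/2)) →
        (∃ i j : Fin d, i ≠ j ∧ (x i = -(1/2) ∨ x i = 1/2) ∧
          (x j = -(1/2) ∨ x j = 1/2)) →
        f x = 0 := by
  obtain ⟨n, rfl⟩ : ∃ n, d = n + 1 := ⟨d - 1, by omega⟩
  let u : Fin (n + 1) → ℝ → ℝ :=
    Fin.cons (fun t => Real.cosh (√n * Real.pi * t)) fun _ t => Real.cos (Real.pi * t)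
  let c : Fin (n + 1) → ℝ := Fin.cons ((√n * Real.pi) ^ 2) fun _ => -Real.pi ^ 2
  refine ⟨fun x => ∏ i, u i (x i), isHarmonic_prod (c := c) ?_ ?_ ?_, ?_, ?_⟩
  · refine Fin.cases ?_ fun i => ?_
    · exact Real.contDiff_cosh.comp (contDiff_const.mul contDiff_id)
    · exact Real.contDiff_cos.comp (contDiff_const.mul contDiff_id)
  · refine Fin.cases ?_ fun i => ?_
    · exact deriv_deriv_cosh_const_mul _
    · exact deriv_deriv_cos_const_mul _
  · simp [c, Fin.sum_univ_succ, mul_pow]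
  · intro h
    simpa [u, Fin.prod_univ_succ] using congrFun h 0
  · rintro x - ⟨i, j, hij, hi, hj⟩
    have hu : ∀ k ≠ 0, (x k = -(1/2) ∨ x k = 1/2) → u k (x k) = 0 := by
      intro k hk hx
      obtain ⟨m, rfl⟩ := Fin.exists_succ_eq.2 hk
      have hpi : Real.cos (Real.pi * (1 / 2)) = 0 := by
        rw [mul_one_div, Real.cos_pi_div_two]
      rcases hx with hx | hx <;> simp only [u, Fin.cons_succ, hx, mul_neg, Real.cos_neg, hpi]
    rcases eq_or_ne i 0 with rfl | hi0
    · exact Finset.prod_eq_zero (Finset.mem_univ j) (hu j hij.symm hj)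
    · exact Finset.prod_eq_zero (Finset.mem_univ i) (hu i hi0 hi)
end

section
/- For every natural number d ≥ 2, the polynomial function g : ℝ^d → ℝ defined by g(x) = x_1 ⋯ x_d · ∏_{1 ≤ i < j ≤ d} (x_i² − x_j²) is harmonic on all of ℝ^d. -/
open Function Matrix

/-- The second partial derivative is the second derivative along the coordinate line. -/
theorem secondPartial_eq_deriv_deriv_update {d : ℕ} {f : (Fin d → ℝ) → ℝ}
    (hf : ContDiff ℝ (⊤ : ℕ∞) f) (k : Fin d) (x : Fin d → ℝ) :
    secondPartial f k x = deriv (deriv fun t => f (update x k t)) (x k) := by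
  have deriv_update {g : (Fin d → ℝ) → ℝ} (hg : Differentiable ℝ g) (t : ℝ) :
      deriv (fun s => g (update x k s)) t = fderiv ℝ g (update x k t) (Pi.single k 1) :=
    ((hg _).hasFDerivAt.comp_hasDerivAt t (hasDerivAt_update x k t)).deriv
  have hf' : Differentiable ℝ fun y => fderiv ℝ f y (Pi.single k 1) :=
    ((hf.fderiv_right (m := 1) (by norm_cast)).differentiable one_ne_zero).clm_apply
      (differentiable_const _)
  rw [funext (deriv_update (hf.differentiable (by simp))), deriv_update hf', update_eq_self]
  rfl

/-- The matrix whose `k`-th column consists of the odd powers `x k, x k ^ 3, x k ^ 5, …`. -/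
def oddPowerMatrix {d : ℕ} (x : Fin d → ℝ) : Matrix (Fin d) (Fin d) ℝ :=
  Matrix.of fun j k => x k ^ (2 * (j : ℕ) + 1)

theorem det_oddPowerMatrix {d : ℕ} (x : Fin d → ℝ) :
    (oddPowerMatrix x).det =
      (∏ k, x k) * ∏ i : Fin d, ∏ j ∈ Finset.Ioi i, (x j ^ 2 - x i ^ 2) := by
  rw [← det_vandermonde, ← det_mul_column, ← det_transpose]
  congr 1
  ext i j
  simp only [oddPowerMatrix, transpose_apply, of_apply, vandermonde_apply]
  ring

theorem det_oddPowerMatrix_update {d : ℕ} (x : Fin d → ℝ) (k : Fin d) (t : ℝ) :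
    (oddPowerMatrix (update x k t)).det =
      ∑ j : Fin d, (oddPowerMatrix x).adjugate k j * t ^ (2 * (j : ℕ) + 1) := by
  have h : oddPowerMatrix (update x k t) =
      (oddPowerMatrix x).updateCol k fun j => t ^ (2 * (j : ℕ) + 1) := by
    ext j l
    by_cases hl : l = k
    · subst hl; simp [oddPowerMatrix]
    · simp [oddPowerMatrix, hl]
  rw [h, ← cramer_apply, cramer_eq_adjugate_mulVec]
  rfl

theorem deriv_deriv_sum_mul_pow {ι : Type*} [Fintype ι] (a : ι → ℝ) (n : ι → ℕ) (t : ℝ) :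
    deriv (deriv fun s : ℝ => ∑ j, a j * s ^ n j) t =
      ∑ j, a j * (n j * (((n j - 1 : ℕ) : ℝ) * t ^ (n j - 1 - 1))) := by
  have h : (deriv fun s : ℝ => ∑ j, a j * s ^ n j) =
      fun s => ∑ j, a j * (n j * s ^ (n j - 1)) :=
    funext fun s => (HasDerivAt.fun_sum fun j _ => (hasDerivAt_pow (n j) s).const_mul (a j)).deriv
  rw [h]
  exact (HasDerivAt.fun_sum fun j _ =>
    ((hasDerivAt_pow (n j - 1) t).const_mul (n j : ℝ)).const_mul (a j)).deriv

theorem sum_adjugate_oddPowerMatrix_mul_pow {d : ℕ} (x : Fin d → ℝ) {j : Fin d}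
    (hj : (j : ℕ) ≠ 0) :
    ∑ k, (oddPowerMatrix x).adjugate k j * x k ^ (2 * (j : ℕ) - 1) = 0 := by
  let i : Fin d := ⟨j - 1, by omega⟩
  have hij : i ≠ j := fun h => by have := congrArg Fin.val h; simp only [i] at this; omega
  have h := congrFun₂ (mul_adjugate (oddPowerMatrix x)) i j
  rw [mul_apply, Matrix.smul_apply, one_apply_ne hij, smul_zero] at h
  rw [← h]
  refine Finset.sum_congr rfl fun k _ => ?_
  rw [mul_comm, oddPowerMatrix, of_apply, show 2 * (i : ℕ) + 1 = 2 * (j : ℕ) - 1 by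
    simp only [i]; omega]

theorem contDiff_det_oddPowerMatrix {d : ℕ} :
    ContDiff ℝ (⊤ : ℕ∞) fun x : Fin d → ℝ => (oddPowerMatrix x).det := by
  simp only [det_oddPowerMatrix]
  fun_prop

theorem isHarmonic_det_oddPowerMatrix {d : ℕ} :
    IsHarmonic fun x : Fin d → ℝ => (oddPowerMatrix x).det := by
  refine ⟨contDiff_det_oddPowerMatrix, fun x => ?_⟩
  simp only [secondPartial_eq_deriv_deriv_update contDiff_det_oddPowerMatrix,
    det_oddPowerMatrix_update, deriv_deriv_sum_mul_pow]
  rw [Finset.sum_comm]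
  refine Finset.sum_eq_zero fun j _ => ?_
  by_cases hj : (j : ℕ) = 0
  · simp [hj]
  · rw [← mul_zero (((2 * (j : ℕ) + 1 : ℕ) : ℝ) * ((2 * (j : ℕ) : ℕ) : ℝ)),
      ← sum_adjugate_oddPowerMatrix_mul_pow x hj, Finset.mul_sum]
    refine Finset.sum_congr rfl fun k _ => ?_
    rw [Nat.add_sub_cancel]
    ring

theorem IsHarmonic.const_mul {d : ℕ} {f : (Fin d → ℝ) → ℝ} (hf : IsHarmonic f) (c : ℝ) :
    IsHarmonic fun x => c * f x := by
  have hcf : ContDiff ℝ (⊤ : ℕ∞) fun x => c * f x := contDiff_const.mul hf.1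
  refine ⟨hcf, fun x => ?_⟩
  have h := hf.2 x
  simp only [secondPartial_eq_deriv_deriv_update hf.1] at h
  simp only [secondPartial_eq_deriv_deriv_update hcf, deriv_const_mul_field', ← Finset.mul_sum, h,
    mul_zero]

/-- For every `d ≥ 2`, the function `g(x) = x_1 ⋯ x_d · ∏_{1 ≤ i < j ≤ d} (x_i² − x_j²)`
is harmonic on all of `ℝ^d`. -/
theorem product_vandermonde_of_squares_harmonic (d : ℕ) (hd : 2 ≤ d) :
    IsHarmonic (fun x : Fin d → ℝ =>
      (∏ k : Fin d, x k) * ∏ i : Fin d, ∏ j ∈ Finset.Ioi i, (x i ^ 2 - x j ^ 2)) := by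
  have h := (isHarmonic_det_oddPowerMatrix (d := d)).const_mul
    (∏ i : Fin d, ∏ _j ∈ Finset.Ioi i, (-1))
  convert h using 2 with x
  rw [det_oddPowerMatrix, mul_left_comm, ← Finset.prod_mul_distrib]
  simp only [← Finset.prod_mul_distrib, neg_one_mul, neg_sub]
end

section
/- For every natural number d ≥ 2, the function h : ℝ^d → ℝ defined by h(x) = e^{x_1} ⋯ e^{x_d} · ∏_{1 ≤ i < j ≤ d} (x_i − x_j) satisfies Δh(x) = d · h(x) for all x ∈ ℝ^d; that is, h is an eigenfunction of the Laplacian with eigenvalue d. -/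
theorem det_updateRow_eq_sum {n R : Type*} [Fintype n] [DecidableEq n] [CommRing R]
    (M : Matrix n n R) (k : n) (b : n → R) :
    (M.updateRow k b).det = ∑ j, M.adjugate j k * b j := by
  rw [← Matrix.cramer_transpose_apply, Matrix.cramer_eq_adjugate_mulVec,
    ← Matrix.adjugate_transpose]
  rfl

open Matrix in
/-- Replacing each row of `M` in turn by the corresponding row of `M * B` and summing the
determinants yields `trace B * det M`. -/
theorem sum_det_updateRow_mul {n R : Type*} [Fintype n] [DecidableEq n] [CommRing R]
    (M B : Matrix n n R) :
    ∑ k, (M.updateRow k ((M * B) k)).det = B.trace * M.det := by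
  have key : ∀ k, (M.updateRow k ((M * B) k)).det = ((M * B) * M.adjugate) k k := by
    intro k
    rw [det_updateRow_eq_sum, mul_apply]
    exact Finset.sum_congr rfl fun _ _ => mul_comm _ _
  calc ∑ k, (M.updateRow k ((M * B) k)).det = (M * B * M.adjugate).trace := by
        simp only [key]; rfl
    _ = B.trace * M.det := by
        rw [mul_assoc, trace_mul_comm, mul_assoc, adjugate_mul, mul_smul_comm, mul_one, trace_smul,
          smul_eq_mul, mul_comm]

theorem fderiv_apply_single_eq_of_hasDerivAt_update {ι : Type*} [Fintype ι] [DecidableEq ι]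
    {f : (ι → ℝ) → ℝ} {x : ι → ℝ} {k : ι} {c : ℝ} (hf : DifferentiableAt ℝ f x)
    (hc : HasDerivAt (fun t => f (Function.update x k t)) c (x k)) :
    fderiv ℝ f x (Pi.single k 1) = c := by
  have hx : Function.update x k (x k) = x := Function.update_eq_self k x
  have hf' : HasFDerivAt f (fderiv ℝ f x) (Function.update x k (x k)) := by
    rw [hx]; exact hf.hasFDerivAt
  exact (hf'.comp_hasDerivAt (x k) (hasDerivAt_update x k (x k))).unique hc

/-- A determinant whose `i`-th row depends only on the variable `x i` is differentiated in the
`k`-th direction by differentiating its `k`-th row. -/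
theorem fderiv_det_apply_single {ι : Type*} [Fintype ι] [DecidableEq ι]
    {g : ι → ι → ℝ → ℝ} (hg : ∀ i j, Differentiable ℝ (g i j)) {k : ι} {g' : ι → ℝ → ℝ}
    (hg' : ∀ j t, HasDerivAt (g k j) (g' j t) t) (x : ι → ℝ) :
    fderiv ℝ (fun y : ι → ℝ => (Matrix.of fun i j => g i j (y i)).det) x (Pi.single k 1) =
      (Matrix.of fun i j => Function.update g k g' i j (x i)).det := by
  have expand : ∀ (g₁ : ι → ℝ → ℝ) (t : ℝ),
      (Matrix.of fun i j => Function.update g k g₁ i j (Function.update x k t i)).det =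
        ∑ j, (Matrix.of fun i j => g i j (x i)).adjugate j k * g₁ j t := by
    intro g₁ t
    have : (Matrix.of fun i j => Function.update g k g₁ i j (Function.update x k t i)) =
        (Matrix.of fun i j => g i j (x i)).updateRow k fun j => g₁ j t := by
      ext i j
      by_cases hi : i = k
      · subst hi; simp
      · simp [hi]
    rw [this, det_updateRow_eq_sum]
  apply fderiv_apply_single_eq_of_hasDerivAt_update
  · simp only [Matrix.det_apply, Matrix.of_apply]
    fun_prop
  · have h₁ := expand g' (x k)
    rw [Function.update_eq_self] at h₁
    rw [h₁]
    have h₂ := fun t => expand (g k) t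
    simp only [Function.update_eq_self] at h₂
    simp only [h₂]
    exact HasDerivAt.fun_sum fun j _ => (hg' j (x k)).const_mul _

theorem hasDerivAt_exp_mul_neg_pow (n : ℕ) (t : ℝ) :
    HasDerivAt (fun t => Real.exp t * (-t) ^ n)
      (Real.exp t * ((-t) ^ n - n * (-t) ^ (n - 1))) t := by
  refine ((Real.hasDerivAt_exp t).fun_mul ((hasDerivAt_neg t).fun_pow n)).congr_deriv ?_
  ring

theorem hasDerivAt_exp_mul_neg_pow_deriv (n : ℕ) (t : ℝ) :
    HasDerivAt (fun t => Real.exp t * ((-t) ^ n - n * (-t) ^ (n - 1)))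
      (Real.exp t * ((-t) ^ n - 2 * n * (-t) ^ (n - 1) +
        n * (n - 1 : ℕ) * (-t) ^ (n - 2))) t := by
  have h := (hasDerivAt_exp_mul_neg_pow n t).fun_sub
    ((hasDerivAt_exp_mul_neg_pow (n - 1) t).const_mul (n : ℝ))
  rw [Nat.sub_sub] at h
  refine (h.congr_deriv (by ring)).congr_of_eventuallyEq (.of_forall fun s => ?_)
  ring

/-- The matrix of the second derivative on the functions `exp t * (-t) ^ j`, for `j < d`. -/
def expNegPowSecondDeriv (d : ℕ) : Matrix (Fin d) (Fin d) ℝ :=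
  Matrix.of fun l j => (if (l : ℕ) = j then 1 else 0) -
    (if (l : ℕ) + 1 = j then 2 * ((j : ℕ) : ℝ) else 0) +
    (if (l : ℕ) + 2 = j then ((j : ℕ) : ℝ) * ((j : ℕ) - 1 : ℕ) else 0)

theorem trace_expNegPowSecondDeriv (d : ℕ) : (expNegPowSecondDeriv d).trace = d := by
  simp [Matrix.trace, expNegPowSecondDeriv]

theorem sum_ite_add_eq {d : ℕ} (u : ℕ → ℝ) (c : ℝ) (a : ℕ) (j : Fin d)
    (hc : (j : ℕ) < a → c = 0) :
    ∑ l : Fin d, u l * (if (l : ℕ) + a = j then c else 0) = u (j - a) * c := by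
  by_cases hj : (j : ℕ) < a
  · simp [hc hj]
  · have hlt : (j : ℕ) - a < d := by omega
    rw [Finset.sum_eq_single (⟨j - a, hlt⟩ : Fin d)]
    · simp [Nat.sub_add_cancel (not_lt.mp hj)]
    · intro l _ hl
      rw [if_neg, mul_zero]
      intro h
      exact hl (Fin.ext (by simp; omega))
    · simp

theorem sum_exp_mul_neg_pow_mul_expNegPowSecondDeriv {d : ℕ} (t : ℝ) (j : Fin d) :
    ∑ l : Fin d, Real.exp t * (-t) ^ (l : ℕ) * expNegPowSecondDeriv d l j =
      Real.exp t * ((-t) ^ (j : ℕ) - 2 * (j : ℕ) * (-t) ^ ((j : ℕ) - 1) +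
        (j : ℕ) * ((j : ℕ) - 1 : ℕ) * (-t) ^ ((j : ℕ) - 2)) := by
  simp only [expNegPowSecondDeriv, Matrix.of_apply, mul_add, mul_sub, Finset.sum_add_distrib,
    Finset.sum_sub_distrib]
  have h₀ := sum_ite_add_eq (fun n => Real.exp t * (-t) ^ n) 1 0 j (by simp)
  have h₁ := sum_ite_add_eq (fun n => Real.exp t * (-t) ^ n) (2 * ((j : ℕ) : ℝ)) 1 j
    (by intro h; simp; omega)
  have h₂ := sum_ite_add_eq (fun n => Real.exp t * (-t) ^ n)
    (((j : ℕ) : ℝ) * ((j : ℕ) - 1 : ℕ)) 2 j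
    (by intro h; rw [← Nat.cast_mul, Nat.cast_eq_zero, mul_eq_zero]; omega)
  simp only [add_zero, Nat.sub_zero] at h₀
  rw [h₀, h₁, h₂]
  ring

theorem prod_exp_mul_prod_sub_eq_det {d : ℕ} (x : Fin d → ℝ) :
    (∏ k : Fin d, Real.exp (x k)) * ∏ i : Fin d, ∏ j ∈ Finset.Ioi i, (x i - x j) =
      (Matrix.of fun i j : Fin d => Real.exp (x i) * (-x i) ^ (j : ℕ)).det := by
  have h := Matrix.det_mul_column (fun i => Real.exp (x i)) (Matrix.vandermonde fun i => -x i)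
  rw [Matrix.det_vandermonde] at h
  simp only [neg_sub_neg, Matrix.vandermonde_apply] at h
  exact h.symm

/-- For every `d ≥ 2`, the function `h(x) = e^{x_1} ⋯ e^{x_d} · ∏_{1 ≤ i < j ≤ d} (x_i − x_j)`
satisfies `Δh = d · h`, i.e. it is an eigenfunction of the Laplacian with eigenvalue `d`. -/
theorem exp_vandermonde_laplacian_eigenfunction (d : ℕ) (hd : 2 ≤ d)
    (h : (Fin d → ℝ) → ℝ)
    (hh : ∀ x, h x = (∏ k : Fin d, Real.exp (x k)) *
      ∏ i : Fin d, ∏ j ∈ Finset.Ioi i, (x i - x j)) :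
    ∀ x, ∑ k, secondPartial h k x = d * h x := by
  intro x
  let g : Fin d → Fin d → ℝ → ℝ := fun _ j t => Real.exp t * (-t) ^ (j : ℕ)
  let g₁ : Fin d → ℝ → ℝ := fun j t =>
    Real.exp t * ((-t) ^ (j : ℕ) - (j : ℕ) * (-t) ^ ((j : ℕ) - 1))
  let g₂ : Fin d → ℝ → ℝ := fun j t =>
    Real.exp t * ((-t) ^ (j : ℕ) - 2 * (j : ℕ) * (-t) ^ ((j : ℕ) - 1) +
        (j : ℕ) * ((j : ℕ) - 1 : ℕ) * (-t) ^ ((j : ℕ) - 2))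
  have hdet : h = fun x => (Matrix.of fun i j => g i j (x i)).det :=
    funext fun x => (hh x).trans (prod_exp_mul_prod_sub_eq_det x)
  have hg : ∀ i j, Differentiable ℝ (g i j) := fun _ j t =>
    (hasDerivAt_exp_mul_neg_pow j t).differentiableAt
  have hsecond : ∀ k, secondPartial h k x =
      ((Matrix.of fun i j => g i j (x i)).updateRow k
        (((Matrix.of fun i j => g i j (x i)) * expNegPowSecondDeriv d) k)).det := by
    intro k
    have hfirst : (fun y => fderiv ℝ h y (Pi.single k 1)) =
        fun y => (Matrix.of fun i j => Function.update g k g₁ i j (y i)).det := by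
      rw [hdet]
      exact funext fun y => fderiv_det_apply_single hg
        (fun j t => hasDerivAt_exp_mul_neg_pow j t) y
    have hg₁ : ∀ i j, Differentiable ℝ (Function.update g k g₁ i j) := by
      intro i j
      by_cases hi : i = k
      · subst hi
        rw [Function.update_self]
        exact fun t => (hasDerivAt_exp_mul_neg_pow_deriv j t).differentiableAt
      · rw [Function.update_of_ne hi]
        exact hg i j
    rw [secondPartial, hfirst, fderiv_det_apply_single (k := k) (g' := g₂) hg₁ (by
      intro j t
      rw [Function.update_self]
      exact hasDerivAt_exp_mul_neg_pow_deriv j t), Function.update_idem]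
    congr 1
    ext i j
    by_cases hi : i = k
    · subst hi
      simp only [Matrix.of_apply, Function.update_self, Matrix.updateRow_self, Matrix.mul_apply]
      exact (sum_exp_mul_neg_pow_mul_expNegPowSecondDeriv (x i) j).symm
    · simp [hi]
  simp only [hsecond]
  rw [sum_det_updateRow_mul, trace_expNegPowSecondDeriv, hdet]
end

section
/- For every natural number d ≥ 2, the Vandermonde polynomial V : ℝ^d → ℝ defined by V(y) = ∏_{1 ≤ i < j ≤ d} (y_i − y_j) is harmonic on ℝ^d, i.e. Σ_{i=1}^d ∂²V/∂y_i²(y) = 0 for all y ∈ ℝ^d. -/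
namespace Matrix

variable {n R : Type*} [Fintype n] [DecidableEq n] [CommRing R]

theorem det_updateRow_eq_sum_mul_adjugate (A : Matrix n n R) (i : n) (b : n → R) :
    (A.updateRow i b).det = ∑ j, b j * A.adjugate j i := by
  rw [← det_transpose, ← updateCol_transpose, ← cramer_apply, cramer_eq_adjugate_mulVec,
    ← adjugate_transpose]
  simp [mulVec, dotProduct, mul_comm]

theorem det_updateCol_eq_sum_adjugate_mul (A : Matrix n n R) (j : n) (b : n → R) :
    (A.updateCol j b).det = ∑ i, A.adjugate j i * b i := by
  rw [← cramer_apply, cramer_eq_adjugate_mulVec]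
  rfl

theorem sum_det_updateRow_eq_sum_det_updateCol (A B : Matrix n n R) :
    ∑ i, (A.updateRow i (B i)).det = ∑ j, (A.updateCol j (Bᵀ j)).det := by
  simp only [det_updateRow_eq_sum_mul_adjugate, det_updateCol_eq_sum_adjugate_mul,
    transpose_apply]
  rw [Finset.sum_comm]
  simp only [mul_comm]

end Matrix

section PolynomialDeterminant

open Polynomial

variable {d : ℕ}

/-- The determinant of the matrix whose `(i, j)` entry is the polynomial `P i j` evaluated at the
`i`-th variable. -/
noncomputable def polyDet (P : Fin d → Fin d → ℝ[X]) (y : Fin d → ℝ) : ℝ :=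
  (Matrix.of fun i j => (P i j).eval (y i)).det

theorem contDiff_polyDet (P : Fin d → Fin d → ℝ[X]) : ContDiff ℝ (⊤ : ℕ∞) (polyDet P) := by
  unfold polyDet
  simp only [Matrix.det_apply', Matrix.of_apply]
  refine ContDiff.sum fun σ _ => contDiff_const.mul (contDiff_prod fun i _ => ?_)
  exact (Polynomial.contDiff_aeval (P (σ i) i) _).comp (contDiff_apply ℝ ℝ (σ i))

theorem polyDet_update_derivative (P : Fin d → Fin d → ℝ[X]) (k : Fin d) (y : Fin d → ℝ) :
    polyDet (Function.update P k fun j => derivative (P k j)) y =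
      ((Matrix.of fun i j => (P i j).eval (y i)).updateRow k
        fun j => (derivative (P k j)).eval (y k)).det := by
  unfold polyDet
  congr 1
  ext i j
  rcases eq_or_ne i k with rfl | h
  · simp
  · simp [h]

theorem fderiv_polyDet_single (P : Fin d → Fin d → ℝ[X]) (k : Fin d) (y : Fin d → ℝ) :
    fderiv ℝ (polyDet P) y (Pi.single k 1) =
      polyDet (Function.update P k fun j => derivative (P k j)) y := by
  have hP : DifferentiableAt ℝ (polyDet P) y :=
    (contDiff_polyDet P).differentiable (by simp) y
  rw [← hP.lineDeriv_eq_fderiv, polyDet_update_derivative,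
    Matrix.det_updateRow_eq_sum_mul_adjugate]
  set A : Matrix (Fin d) (Fin d) ℝ := Matrix.of fun i j => (P i j).eval (y i) with hA
  have hline (t : ℝ) : polyDet P (y + t • Pi.single k 1) =
      ∑ j, (P k j).eval (y k + t) * A.adjugate j k := by
    rw [← Matrix.det_updateRow_eq_sum_mul_adjugate, polyDet]
    congr 1
    ext i j
    rcases eq_or_ne i k with rfl | h
    · simp
    · simp [h, hA]
  simp only [lineDeriv, hline]
  refine HasDerivAt.deriv (HasDerivAt.fun_sum fun j _ => HasDerivAt.mul_const ?_ _)
  have h := (P k j).hasDerivAt (y k + 0)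
  simpa using h.comp_const_add (y k) 0

theorem secondPartial_polyDet (P : Fin d → Fin d → ℝ[X]) (k : Fin d) (y : Fin d → ℝ) :
    secondPartial (polyDet P) k y =
      ((Matrix.of fun i j => (P i j).eval (y i)).updateRow k
        fun j => (derivative (derivative (P k j))).eval (y k)).det := by
  simp only [secondPartial, fderiv_polyDet_single, Function.update_self, Function.update_idem]
  unfold polyDet
  congr 1
  ext i j
  rcases eq_or_ne i k with rfl | h
  · simp
  · simp [h]

theorem prod_sub_eq_polyDet (y : Fin d → ℝ) :
    ∏ i : Fin d, ∏ j ∈ Finset.Ioi i, (y i - y j) = polyDet (fun _ j => (-X) ^ (j : ℕ)) y := by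
  have h := Matrix.det_vandermonde (fun i => -y i)
  simp only [neg_sub_neg] at h
  rw [← h, polyDet]
  congr 1
  ext i j
  simp

theorem derivative_derivative_neg_X_pow (m : ℕ) :
    derivative (derivative ((-X : ℝ[X]) ^ m)) =
      C ((m : ℝ) * ((m - 1 : ℕ) : ℝ)) * (-X) ^ (m - 1 - 1) := by
  simp [derivative_pow]
  ring

end PolynomialDeterminant

/-- For every `d ≥ 2`, the Vandermonde polynomial `V(y) = ∏_{1 ≤ i < j ≤ d} (y_i − y_j)`
is harmonic on all of `ℝ^d`. -/
theorem vandermonde_harmonic (d : ℕ) (hd : 2 ≤ d) :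
    IsHarmonic (fun y : Fin d → ℝ =>
      ∏ i : Fin d, ∏ j ∈ Finset.Ioi i, (y i - y j)) := by
  have hV : (fun y : Fin d → ℝ => ∏ i : Fin d, ∏ j ∈ Finset.Ioi i, (y i - y j)) =
      polyDet (fun _ j => (-Polynomial.X) ^ (j : ℕ)) := funext prod_sub_eq_polyDet
  rw [hV]
  refine ⟨contDiff_polyDet _, fun y => ?_⟩
  simp only [secondPartial_polyDet]
  refine (Matrix.sum_det_updateRow_eq_sum_det_updateCol _ (Matrix.of fun i j : Fin d =>
    (Polynomial.derivative (Polynomial.derivative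
      ((-Polynomial.X : Polynomial ℝ) ^ (j : ℕ)))).eval (y i))).trans ?_
  refine Finset.sum_eq_zero fun j _ => ?_
  rcases lt_or_ge (j : ℕ) 2 with hj | hj
  · refine Matrix.det_eq_zero_of_column_eq_zero j fun i => ?_
    have hj' : (j : ℕ) = 0 ∨ (j : ℕ) - 1 = 0 := by omega
    rcases hj' with h | h <;> simp [derivative_derivative_neg_X_pow, h]
  · let l : Fin d := ⟨(j : ℕ) - 1 - 1, by omega⟩
    have hl : j ≠ l := fun h => by
      have := congrArg Fin.val h
      simp only [l] at this
      omega
    rw [show (Matrix.of fun i j : Fin d => (Polynomial.derivative (Polynomial.derivative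
        ((-Polynomial.X : Polynomial ℝ) ^ (j : ℕ)))).eval (y i)).transpose j =
        ((j : ℝ) * (((j : ℕ) - 1 : ℕ) : ℝ)) • fun i => (-y i) ^ (l : ℕ) by
      ext i
      simp [derivative_derivative_neg_X_pow, l], Matrix.det_updateCol_smul]
    refine mul_eq_zero_of_right _ (Matrix.det_zero_of_column_eq hl fun i => ?_)
    simp [hl.symm]
end

section
/- For every natural number d ≥ 2, the Vandermonde polynomial V(y) = ∏_{1 ≤ i < j ≤ d} (y_i − y_j) satisfies Σ_{i=1}^d y_i · ∂²V/∂y_i²(y) = 0 for all y ∈ ℝ^d. -/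
/-- The directional derivative of a monomial along a coordinate vector. -/
lemma fderiv_prod_pow_single {ι : Type*} [Fintype ι] [DecidableEq ι] (e : ι → ℕ) (k : ι)
    (y : ι → ℝ) :
    fderiv ℝ (fun y : ι → ℝ => ∏ i, y i ^ e i) y (Pi.single k 1) =
      e k * ∏ i, y i ^ Function.update e k (e k - 1) i := by
  have h : HasFDerivAt (fun y : ι → ℝ => ∏ i, y i ^ e i) _ y :=
    HasFDerivAt.finsetProd (u := Finset.univ) fun i _ =>
      (hasFDerivAt_apply (𝕜 := ℝ) i y).pow (e i)
  rw [h.fderiv]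
  simp only [sum_apply, smul_apply,
    ContinuousLinearMap.proj_apply, smul_eq_mul]
  rw [Finset.sum_eq_single k (by intro b _ hb; simp [hb]) (by simp)]
  rw [← Finset.mul_prod_erase _ _ (Finset.mem_univ k)]
  have h_erase : ∏ i ∈ Finset.univ.erase k, y i ^ Function.update e k (e k - 1) i =
      ∏ i ∈ Finset.univ.erase k, y i ^ e i :=
    Finset.prod_congr rfl fun i hi => by
      rw [Function.update_of_ne (Finset.ne_of_mem_erase hi)]
  rw [h_erase]
  simp
  ring

/-- The directional derivative of a polynomial function along a coordinate vector. -/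
lemma fderiv_sum_prod_pow_single {ι κ : Type*} [Fintype ι] [DecidableEq ι] [Fintype κ]
    (c : κ → ℝ) (e : κ → ι → ℕ) (k : ι) (y : ι → ℝ) :
    fderiv ℝ (fun y : ι → ℝ => ∑ s, c s * ∏ i, y i ^ e s i) y (Pi.single k 1) =
      ∑ s, c s * e s k * ∏ i, y i ^ Function.update (e s) k (e s k - 1) i := by
  have hd (s : κ) : DifferentiableAt ℝ (fun y : ι → ℝ => ∏ i, y i ^ e s i) y := by fun_prop
  rw [fderiv_fun_sum fun s _ => (hd s).const_mul (c s)]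
  simp only [sum_apply]
  refine Finset.sum_congr rfl fun s _ => ?_
  rw [fderiv_const_mul (hd s), smul_apply, fderiv_prod_pow_single,
    smul_eq_mul, mul_assoc]

lemma mul_secondPartial_sum_prod_pow {d : ℕ} {κ : Type*} [Fintype κ]
    (c : κ → ℝ) (e : κ → Fin d → ℕ) (k : Fin d) (y : Fin d → ℝ) :
    y k * secondPartial (fun y => ∑ s, c s * ∏ i, y i ^ e s i) k y =
      ∑ s, c s * (e s k * (e s k - 1 : ℕ) *
        ∏ i, y i ^ Function.update (e s) k (e s k - 1) i) := by
  simp only [secondPartial, fderiv_sum_prod_pow_single, Function.update_self,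
    Function.update_idem, Finset.mul_sum]
  refine Finset.sum_congr rfl fun s _ => ?_
  obtain h | h := Nat.eq_zero_or_pos (e s k - 1)
  · simp [h]
  have hprod : y k * ∏ i, y i ^ Function.update (e s) k (e s k - 1 - 1) i =
      ∏ i, y i ^ Function.update (e s) k (e s k - 1) i := by
    simp only [← Finset.mul_prod_erase _ _ (Finset.mem_univ k), Function.update_self]
    rw [← mul_assoc, mul_pow_sub_one h.ne']
    refine congrArg _ (Finset.prod_congr rfl fun i hi => ?_)
    simp only [Function.update_of_ne (Finset.ne_of_mem_erase hi)]
  rw [← hprod]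
  ring

/-- Lowering the exponent of one column of a Vandermonde matrix makes two columns equal, so the
determinant vanishes. -/
lemma sum_sign_mul_prod_pow_update_eq_zero {d : ℕ} (y : Fin d → ℝ) (j : Fin d)
    (hj : (j : ℕ) ≠ 0) :
    ∑ σ : Equiv.Perm (Fin d), ((Equiv.Perm.sign σ : ℤ) : ℝ) *
      ∏ i, y (σ i) ^ Function.update (fun l : Fin d => (l : ℕ)) j (j - 1) i = 0 := by
  have hlt : (j : ℕ) - 1 < d := by omega
  have hne : j ≠ ⟨(j : ℕ) - 1, hlt⟩ := by
    intro h
    have := congrArg Fin.val h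
    simp only at this
    omega
  have h := Matrix.det_zero_of_column_eq
    (M := Matrix.of fun i l => y i ^ Function.update (fun l : Fin d => (l : ℕ)) j (j - 1) l) hne
    fun i => by simp [Function.update_of_ne hne.symm]
  rwa [Matrix.det_apply'] at h

lemma prod_sub_eq_sum_perm {d : ℕ} (y : Fin d → ℝ) :
    ∏ i : Fin d, ∏ j ∈ Finset.Ioi i, (y i - y j) =
      ∑ σ : Equiv.Perm (Fin d),
        (∏ i : Fin d, ∏ _j ∈ Finset.Ioi i, (-1 : ℝ)) * ((Equiv.Perm.sign σ : ℤ) : ℝ) *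
          ∏ i, y i ^ (σ.symm i : ℕ) := by
  have h : ∏ i : Fin d, ∏ j ∈ Finset.Ioi i, (y i - y j) =
      (∏ i : Fin d, ∏ _j ∈ Finset.Ioi i, (-1 : ℝ)) * (Matrix.vandermonde y).det := by
    simp only [Matrix.det_vandermonde, ← Finset.prod_mul_distrib]
    simp
  rw [h, Matrix.det_apply', Finset.mul_sum]
  refine Finset.sum_congr rfl fun σ _ => ?_
  rw [mul_assoc, ← Equiv.prod_comp σ fun i => y i ^ (σ.symm i : ℕ)]
  simp [Matrix.vandermonde_apply]

/-- For every `d ≥ 2`, the Vandermonde polynomial `V(y) = ∏_{1 ≤ i < j ≤ d} (y_i − y_j)`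
satisfies `Σ_{i=1}^d y_i · ∂²V/∂y_i²(y) = 0` for all `y ∈ ℝ^d`. -/
theorem vandermonde_weighted_sum_secondPartials_eq_zero (d : ℕ) (hd : 2 ≤ d)
    (V : (Fin d → ℝ) → ℝ)
    (hV : ∀ y, V y = ∏ i : Fin d, ∏ j ∈ Finset.Ioi i, (y i - y j)) :
    ∀ y : Fin d → ℝ, ∑ i : Fin d, y i * secondPartial V i y = 0 := by
  intro y
  obtain rfl := funext fun y => (hV y).trans (prod_sub_eq_sum_perm y)
  simp only [mul_secondPartial_sum_prod_pow]
  rw [Finset.sum_comm]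
  have hperm (σ : Equiv.Perm (Fin d)) (j : Fin d) :
      ∏ i, y i ^ Function.update (fun i => (σ.symm i : ℕ)) (σ j) ((j : ℕ) - 1) i =
        ∏ i, y (σ i) ^ Function.update (fun l : Fin d => (l : ℕ)) j (j - 1) i := by
    rw [← Equiv.prod_comp σ]
    refine Finset.prod_congr rfl fun i _ => ?_
    simp [Function.update_apply]
  have hreindex (σ : Equiv.Perm (Fin d)) (c : ℝ) :
      ∑ k, c * ((σ.symm k : ℕ) * ((σ.symm k : ℕ) - 1 : ℕ) *
        ∏ i, y i ^ Function.update (fun i => (σ.symm i : ℕ)) k ((σ.symm k : ℕ) - 1) i) =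
      ∑ j : Fin d, c * ((j : ℕ) * ((j : ℕ) - 1 : ℕ) *
        ∏ i, y (σ i) ^ Function.update (fun l : Fin d => (l : ℕ)) j (j - 1) i) := by
    rw [← Equiv.sum_comp σ]
    simp only [Equiv.symm_apply_apply, hperm]
  simp only [hreindex]
  rw [Finset.sum_comm]
  refine Finset.sum_eq_zero fun j _ => ?_
  obtain hj | hj := eq_or_ne (j : ℕ) 0
  · simp [hj]
  have h := congrArg ((∏ i : Fin d, ∏ _j ∈ Finset.Ioi i, (-1 : ℝ)) *
    ((j : ℕ) * ((j : ℕ) - 1 : ℕ)) * ·) (sum_sign_mul_prod_pow_update_eq_zero y j hj)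
  simp only [mul_zero, Finset.mul_sum] at h
  rw [← h]
  exact Finset.sum_congr rfl fun σ _ => by ring
end

section
/- Let n ≥ 1 and define Φ = (φ_1, φ_2) : ℝ^{2n} → ℝ² by φ_1(x) = Σ_{j=1}^n (x_{2j−1}² − x_{2j}²) and φ_2(x) = Σ_{j=1}^n 2 x_{2j−1} x_{2j}. Then for every function h : ℝ² → ℝ that is harmonic on all of ℝ², the composition h ∘ Φ is harmonic on all of ℝ^{2n}. -/
/-- The index `2j` (0-based), i.e. the `(2j-1)`-st coordinate in 1-based numbering. -/
def idx0 {n : ℕ} (j : Fin n) : Fin (2 * n) := ⟨2 * j.1, by have := j.2; omega⟩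

/-- The index `2j+1` (0-based), i.e. the `2j`-th coordinate in 1-based numbering. -/
def idx1 {n : ℕ} (j : Fin n) : Fin (2 * n) := ⟨2 * j.1 + 1, by have := j.2; omega⟩

theorem sum_eq_sum_idx {n : ℕ} (g : Fin (2 * n) → ℝ) :
    ∑ k, g k = ∑ j : Fin n, (g (idx0 j) + g (idx1 j)) := by
  have hb : Function.Bijective (Sum.elim idx0 idx1 : Fin n ⊕ Fin n → Fin (2 * n)) := by
    constructor
    · rintro (a | a) (b | b) hab <;> simp [idx0, idx1, Fin.ext_iff] at hab ⊢ <;> omega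
    · intro k
      have hk := k.2
      rcases Nat.even_or_odd' k.1 with ⟨c, hc | hc⟩
      · exact ⟨Sum.inl ⟨c, by omega⟩, by simp [idx0, Fin.ext_iff, hc]⟩
      · exact ⟨Sum.inr ⟨c, by omega⟩, by simp [idx1, Fin.ext_iff, hc]⟩
  rw [← hb.sum_comp g, Fintype.sum_sum_type, Finset.sum_add_distrib]
  rfl

/-- The chain rule for the second derivative of `f ∘ Φ` along a fixed direction `e`, where
`V` is the derivative of `Φ` along `e`. -/
theorem fderiv_fderiv_comp_apply {E F : Type*} [NormedAddCommGroup E] [NormedSpace ℝ E]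
    [NormedAddCommGroup F] [NormedSpace ℝ F] {f : F → ℝ} (hf : ContDiff ℝ 2 f)
    {Φ : E → F} (hΦ : Differentiable ℝ Φ) {e : E} {V : E → F}
    (hV : ∀ y, fderiv ℝ Φ y e = V y) (hVd : Differentiable ℝ V) (x : E) :
    fderiv ℝ (fun y => fderiv ℝ (fun z => f (Φ z)) y e) x e =
      fderiv ℝ (fderiv ℝ f) (Φ x) (V x) (V x) + fderiv ℝ f (Φ x) (fderiv ℝ V x e) := by
  have hfd : Differentiable ℝ f := hf.differentiable (by norm_num)
  have hfd' : Differentiable ℝ (fderiv ℝ f) :=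
    (hf.fderiv_right (m := 1) (by norm_num)).differentiable (by norm_num)
  have h1 : (fun y => fderiv ℝ (fun z => f (Φ z)) y e) = fun y => fderiv ℝ f (Φ y) (V y) := by
    funext y
    have := ((hfd (Φ y)).hasFDerivAt.comp y (hΦ y).hasFDerivAt).fderiv
    simp only [Function.comp_def] at this
    rw [this, ContinuousLinearMap.comp_apply, hV]
  have h2 : HasFDerivAt (fun y => fderiv ℝ f (Φ y))
      ((fderiv ℝ (fderiv ℝ f) (Φ x)).comp (fderiv ℝ Φ x)) x :=
    (hfd' (Φ x)).hasFDerivAt.comp x (hΦ x).hasFDerivAt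
  rw [h1, (h2.clm_apply (hVd x).hasFDerivAt).fderiv]
  simp [hV, add_comm]

theorem secondPartial_eq {d : ℕ} {f : (Fin d → ℝ) → ℝ} (hf : ContDiff ℝ 2 f) (k : Fin d)
    (x : Fin d → ℝ) :
    secondPartial f k x = fderiv ℝ (fderiv ℝ f) x (Pi.single k 1) (Pi.single k 1) := by
  have := fderiv_fderiv_comp_apply hf (Φ := id) differentiable_id (e := Pi.single k 1)
    (V := fun _ => Pi.single k 1) (by simp) (differentiable_const _) x
  simpa [secondPartial] using this

/-- In complex notation, the map `z ↦ ∑ⱼ zⱼ²`. -/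
def sumSq {n : ℕ} (x : Fin (2 * n) → ℝ) : Fin 2 → ℝ :=
  ![∑ j : Fin n, (x (idx0 j) ^ 2 - x (idx1 j) ^ 2), ∑ j : Fin n, 2 * x (idx0 j) * x (idx1 j)]

theorem contDiff_sumSq {n : ℕ} {m : WithTop ℕ∞} :
    ContDiff ℝ m (sumSq : (Fin (2 * n) → ℝ) → Fin 2 → ℝ) := by
  rw [contDiff_pi]
  intro i
  fin_cases i <;> simp only [sumSq] <;> simp <;> fun_prop

theorem fderiv_sumSq_apply {n : ℕ} (y e : Fin (2 * n) → ℝ) :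
    fderiv ℝ sumSq y e =
      ![∑ j : Fin n, (2 * y (idx0 j) * e (idx0 j) - 2 * y (idx1 j) * e (idx1 j)),
        ∑ j : Fin n, 2 * (y (idx0 j) * e (idx1 j) + y (idx1 j) * e (idx0 j))] := by
  have hp : ∀ k : Fin (2 * n), HasFDerivAt (fun x : Fin (2 * n) → ℝ => x k)
      (ContinuousLinearMap.proj (R := ℝ) (φ := fun _ : Fin (2 * n) => ℝ) k) y :=
    fun k => hasFDerivAt_apply k y
  have h0 := HasFDerivAt.fun_sum (u := Finset.univ) fun (j : Fin n) _ =>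
    ((hp (idx0 j)).pow 2).sub ((hp (idx1 j)).pow 2)
  have h1 := HasFDerivAt.fun_sum (u := Finset.univ) fun (j : Fin n) _ =>
    ((hp (idx0 j)).const_mul 2).mul (hp (idx1 j))
  have hd : DifferentiableAt ℝ (sumSq : (Fin (2 * n) → ℝ) → Fin 2 → ℝ) y :=
    (contDiff_sumSq (m := 1)).differentiable (by norm_num) y
  have hc := hasFDerivAt_pi'.1 hd.hasFDerivAt
  have e0 := congrArg (fun L => L e) ((hc 0).unique h0)
  have e1 := congrArg (fun L => L e) ((hc 1).unique h1)
  funext i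
  fin_cases i
  · simpa using e0
  · simp at e1 ⊢
    rw [e1]
    exact Finset.sum_congr rfl fun j _ => by ring

theorem idx0_inj {n : ℕ} {i j : Fin n} : idx0 i = idx0 j ↔ i = j := by
  simp [idx0, Fin.ext_iff]

theorem idx1_inj {n : ℕ} {i j : Fin n} : idx1 i = idx1 j ↔ i = j := by
  simp [idx1, Fin.ext_iff]

theorem idx0_ne_idx1 {n : ℕ} (i j : Fin n) : idx0 i ≠ idx1 j := by
  simp [idx0, idx1, Fin.ext_iff]
  omega

theorem fderiv_sumSq_single_idx0 {n : ℕ} (j : Fin n) (y : Fin (2 * n) → ℝ) :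
    fderiv ℝ sumSq y (Pi.single (idx0 j) 1) = ![2 * y (idx0 j), 2 * y (idx1 j)] := by
  rw [fderiv_sumSq_apply]
  simp [Pi.single_apply, idx0_inj, (idx0_ne_idx1 _ _).symm]

theorem fderiv_sumSq_single_idx1 {n : ℕ} (j : Fin n) (y : Fin (2 * n) → ℝ) :
    fderiv ℝ sumSq y (Pi.single (idx1 j) 1) = ![-2 * y (idx1 j), 2 * y (idx0 j)] := by
  rw [fderiv_sumSq_apply]
  simp [Pi.single_apply, idx1_inj, idx0_ne_idx1]

theorem hasFDerivAt_vec_two {d : ℕ} (a b : ℝ) (k l : Fin d) (x : Fin d → ℝ) :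
    HasFDerivAt (fun y : Fin d → ℝ => ![a * y k, b * y l])
      (ContinuousLinearMap.pi ![a • ContinuousLinearMap.proj (R := ℝ) (φ := fun _ : Fin d => ℝ) k,
        b • ContinuousLinearMap.proj (R := ℝ) (φ := fun _ : Fin d => ℝ) l]) x := by
  rw [hasFDerivAt_pi']
  intro i
  fin_cases i
  · exact (hasFDerivAt_apply k x).const_mul a
  · exact (hasFDerivAt_apply l x).const_mul b

theorem secondPartial_comp_sumSq {n : ℕ} {h : (Fin 2 → ℝ) → ℝ} (hh : ContDiff ℝ 2 h)
    {k p q : Fin (2 * n)} {a b : ℝ}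
    (hV : ∀ y, fderiv ℝ sumSq y (Pi.single k 1) = ![a * y p, b * y q]) (x : Fin (2 * n) → ℝ) :
    secondPartial (fun z => h (sumSq z)) k x =
      fderiv ℝ (fderiv ℝ h) (sumSq x) ![a * x p, b * x q] ![a * x p, b * x q] +
        fderiv ℝ h (sumSq x) ![a * (Pi.single k 1 : Fin (2 * n) → ℝ) p,
          b * (Pi.single k 1 : Fin (2 * n) → ℝ) q] := by
  rw [secondPartial, fderiv_fderiv_comp_apply hh
    ((contDiff_sumSq (m := 1)).differentiable (by norm_num)) hV
    (fun y => (hasFDerivAt_vec_two a b p q y).differentiableAt),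
    (hasFDerivAt_vec_two a b p q x).fderiv]
  congr 2
  funext i
  fin_cases i <;> simp

theorem vec_two_eq (a b : ℝ) :
    (![a, b] : Fin 2 → ℝ) = a • Pi.single 0 1 + b • Pi.single 1 1 := by
  funext i
  fin_cases i <;> simp

/-- For `n ≥ 1`, with `φ₁(x) = Σ_j (x_{2j−1}² − x_{2j}²)` and `φ₂(x) = Σ_j 2x_{2j−1}x_{2j}`,
the map `Φ = (φ₁, φ₂) : ℝ^{2n} → ℝ²` pulls back every entire harmonic function on `ℝ²`
to an entire harmonic function on `ℝ^{2n}`. -/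
theorem comp_quadratic_morphism_harmonic (n : ℕ) (hn : 1 ≤ n)
    (h : (Fin 2 → ℝ) → ℝ) (hh : IsHarmonic h) :
    IsHarmonic (fun x : Fin (2 * n) → ℝ =>
      h ![∑ j : Fin n, (x (idx0 j) ^ 2 - x (idx1 j) ^ 2),
          ∑ j : Fin n, 2 * x (idx0 j) * x (idx1 j)]) := by
  have h2 : ContDiff ℝ 2 h := contDiff_infty.1 hh.1 2
  refine ⟨hh.1.comp contDiff_sumSq, fun x => ?_⟩
  rw [sum_eq_sum_idx]
  refine Finset.sum_eq_zero fun j _ => ?_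
  have hL := hh.2 (sumSq x)
  rw [Fin.sum_univ_two, secondPartial_eq h2, secondPartial_eq h2] at hL
  have e0 := secondPartial_comp_sumSq h2 (fderiv_sumSq_single_idx0 j) x
  have e1 := secondPartial_comp_sumSq h2 (fderiv_sumSq_single_idx1 j) x
  refine (congrArg₂ (· + ·) e0 e1).trans ?_
  simp only [vec_two_eq, map_add, map_smul, _root_.add_apply,
    _root_.smul_apply, smul_eq_mul, Pi.single_apply, idx0_ne_idx1,
    (idx0_ne_idx1 _ _).symm, if_true, if_false]
  linear_combination (4 * x (idx0 j) ^ 2 + 4 * x (idx1 j) ^ 2) * hL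
end

section
/- Let m ≥ 3 and let ξ_1, …, ξ_{m−2} : ℂ → ℂ be entire (holomorphic on all of ℂ) functions satisfying Σ_{j=1}^{m−2} ξ_j(z)² = 0 for every z ∈ ℂ. Define φ : ℝ^m → ℂ by φ(x_1,…,x_m) = Σ_{j=1}^{m−2} ξ_j(x_{m−1} + i x_m) · x_j. Then for every entire function F : ℂ → ℂ, the composition F ∘ φ : ℝ^m → ℂ is harmonic on all of ℝ^m (i.e. both its real and imaginary parts are harmonic). -/
/-- The second partial derivative of a complex-valued `f : ℝ^d → ℂ` in the `k`-th
coordinate direction. -/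
noncomputable def secondPartialC {d : ℕ} (f : (Fin d → ℝ) → ℂ) (k : Fin d)
    (x : Fin d → ℝ) : ℂ :=
  fderiv ℝ (fun y => fderiv ℝ f y (Pi.single k 1)) x (Pi.single k 1)

/-- A complex-valued function `f : ℝ^d → ℂ` is harmonic on all of `ℝ^d` if it is smooth
and its Laplacian `Σ_{k=1}^d ∂²f/∂x_k²` vanishes identically (equivalently, its real and
imaginary parts are harmonic). -/
def IsHarmonicC {d : ℕ} (f : (Fin d → ℝ) → ℂ) : Prop :=
  ContDiff ℝ (⊤ : ℕ∞) f ∧ ∀ x, ∑ k, secondPartialC f k x = 0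

theorem Differentiable.hasFDerivAt_comp_real {E : Type*} [NormedAddCommGroup E] [NormedSpace ℝ E]
    {H : ℂ → ℂ} (hH : Differentiable ℂ H) {u : E → ℂ} {u' : E →L[ℝ] ℂ} {x : E}
    (hu : HasFDerivAt u u' x) :
    HasFDerivAt (fun y => H (u y)) (_root_.deriv H (u x) • u') x :=
  (hH (u x)).hasDerivAt.comp_hasFDerivAt x hu

/-- The second order chain rule for an entire function after a real differentiable map. -/
theorem secondPartialC_comp {d : ℕ} {H : ℂ → ℂ} (hH : Differentiable ℂ H)
    {u : (Fin d → ℝ) → ℂ} (hu : Differentiable ℝ u) (k : Fin d) (x : Fin d → ℝ)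
    (hu' : DifferentiableAt ℝ (fun y => fderiv ℝ u y (Pi.single k 1)) x) :
    secondPartialC (fun y => H (u y)) k x =
      deriv (deriv H) (u x) * (fderiv ℝ u x (Pi.single k 1)) ^ 2 +
        deriv H (u x) * secondPartialC u k x := by
  have h₁ : (fun y => fderiv ℝ (fun y => H (u y)) y (Pi.single k 1)) =
      fun y => deriv H (u y) * fderiv ℝ u y (Pi.single k 1) := by
    funext y
    rw [(hH.hasFDerivAt_comp_real (hu y).hasFDerivAt).fderiv]
    simp
  have h₂ := (hH.deriv.hasFDerivAt_comp_real (hu x).hasFDerivAt).fun_mul hu'.hasFDerivAt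
  unfold secondPartialC
  rw [h₁, h₂.fderiv]
  simp
  ring

/-- The derivative of a real-linear combination whose coefficients are entire functions of a
real-linear map. -/
theorem hasFDerivAt_sum_comp_mul {ι E : Type*} [Fintype ι] [NormedAddCommGroup E] [NormedSpace ℝ E]
    {η : ι → ℂ → ℂ} (hη : ∀ j, Differentiable ℂ (η j)) (L : E →L[ℝ] ℂ) (P : ι → E →L[ℝ] ℂ)
    (x : E) :
    HasFDerivAt (fun y => ∑ j, η j (L y) * P j y)
      (∑ j, (η j (L x) • P j + P j x • deriv (η j) (L x) • L)) x :=
  HasFDerivAt.fun_sum fun j _ =>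
    ((hη j).hasFDerivAt_comp_real L.hasFDerivAt).fun_mul (P j).hasFDerivAt

open Complex in
/-- If `∑ j, ξ j ^ 2 = 0` then every entire function of `∑ j, ξ j (x_n + i x_{n+1}) x_j` is
harmonic. -/
theorem isHarmonicC_comp_sum {n : ℕ} {ξ : Fin n → ℂ → ℂ} (hξ : ∀ j, Differentiable ℂ (ξ j))
    (hsum : ∀ z : ℂ, ∑ j, (ξ j z) ^ 2 = 0) {F : ℂ → ℂ} (hF : Differentiable ℂ F) :
    IsHarmonicC (fun x : Fin (n + 2) → ℝ =>
      F (∑ j : Fin n,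
        ξ j ((x (Fin.last n).castSucc : ℂ) + (x (Fin.last (n + 1)) : ℂ) * I) *
          (x j.castSucc.castSucc : ℂ))) := by
  let X (k : Fin (n + 2)) : (Fin (n + 2) → ℝ) →L[ℝ] ℂ :=
    ofRealCLM.comp (ContinuousLinearMap.proj k)
  let L : (Fin (n + 2) → ℝ) →L[ℝ] ℂ := X (Fin.last n).castSucc + I • X (Fin.last (n + 1))
  let P (j : Fin n) := X j.castSucc.castSucc
  let φ (η : Fin n → ℂ → ℂ) (x : Fin (n + 2) → ℝ) : ℂ := ∑ j, η j (L x) * P j x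
  have hX (k l : Fin (n + 2)) : X k (Pi.single l 1) = if k = l then 1 else 0 := by
    simp [X, Pi.single_apply, apply_ite ofReal]
  have hLP (j : Fin n) : L (Pi.single j.castSucc.castSucc 1) = 0 := by
    simp [L, hX, Fin.ext_iff, j.2.ne', (j.2.trans n.lt_succ_self).ne']
  have hL₁ : L (Pi.single (Fin.last n).castSucc 1) = 1 := by
    simp [L, hX, Fin.ext_iff]
  have hL₂ : L (Pi.single (Fin.last (n + 1)) 1) = I := by
    simp [L, hX, Fin.ext_iff]
  have hP (i j : Fin n) : P i (Pi.single j.castSucc.castSucc 1) = if i = j then 1 else 0 := by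
    simp [P, hX]
  have hP₁ (i : Fin n) : P i (Pi.single (Fin.last n).castSucc 1) = 0 := by
    simp [P, hX, Fin.ext_iff, i.2.ne]
  have hP₂ (i : Fin n) : P i (Pi.single (Fin.last (n + 1)) 1) = 0 := by
    simp [P, hX, Fin.ext_iff, (i.2.trans n.lt_succ_self).ne]
  have hφ {η : Fin n → ℂ → ℂ} (hη : ∀ j, Differentiable ℂ (η j)) : Differentiable ℝ (φ η) :=
    fun x => (hasFDerivAt_sum_comp_mul hη L P x).differentiableAt
  have hφ' {η : Fin n → ℂ → ℂ} (hη : ∀ j, Differentiable ℂ (η j)) (x v : Fin (n + 2) → ℝ) :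
      fderiv ℝ (φ η) x v = ∑ j, η j (L x) * P j v + φ (fun j => deriv (η j)) x * L v := by
    rw [(hasFDerivAt_sum_comp_mul hη L P x).fderiv]
    simp [Finset.sum_add_distrib, φ, Finset.sum_mul, mul_comm (P _ x), mul_right_comm]
  have hξ' (j : Fin n) : Differentiable ℂ (deriv (ξ j)) := (hξ j).deriv
  have hd (j : Fin n) : (fun y => fderiv ℝ (φ ξ) y (Pi.single j.castSucc.castSucc 1)) =
      fun y => ξ j (L y) := by
    funext y
    simp [hφ' hξ, hP, hLP]
  have hd₁ : (fun y => fderiv ℝ (φ ξ) y (Pi.single (Fin.last n).castSucc 1)) =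
      φ fun j => deriv (ξ j) := by
    funext y
    simp [hφ' hξ, hP₁, hL₁]
  have hd₂ : (fun y => fderiv ℝ (φ ξ) y (Pi.single (Fin.last (n + 1)) 1)) =
      fun y => φ (fun j => deriv (ξ j)) y * I := by
    funext y
    simp [hφ' hξ, hP₂, hL₂]
  have hs (j : Fin n) (x) : secondPartialC (φ ξ) j.castSucc.castSucc x = 0 := by
    unfold secondPartialC
    rw [hd, ((hξ j).hasFDerivAt_comp_real L.hasFDerivAt).fderiv]
    simp [hLP]
  have hs₁ (x) : secondPartialC (φ ξ) (Fin.last n).castSucc x =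
      φ (fun j => deriv (deriv (ξ j))) x := by
    unfold secondPartialC
    rw [hd₁, hφ' hξ']
    simp [hP₁, hL₁]
  have hs₂ (x) : secondPartialC (φ ξ) (Fin.last (n + 1)) x =
      -φ (fun j => deriv (deriv (ξ j))) x := by
    unfold secondPartialC
    rw [hd₂, fderiv_mul_const (hφ hξ' x)]
    simp [hφ' hξ', hP₂, hL₂, mul_left_comm I]
  have hfun : (fun x : Fin (n + 2) → ℝ => F (∑ j : Fin n,
      ξ j ((x (Fin.last n).castSucc : ℂ) + (x (Fin.last (n + 1)) : ℂ) * I) *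
        (x j.castSucc.castSucc : ℂ))) = fun x => F (φ ξ x) := by
    funext x
    simp [φ, L, P, X, mul_comm I]
  rw [hfun]
  refine ⟨?_, fun x => ?_⟩
  · have hsmooth {H : ℂ → ℂ} (hH : Differentiable ℂ H) : ContDiff ℝ (⊤ : ℕ∞) H :=
      hH.contDiff.restrict_scalars ℝ
    exact (hsmooth hF).comp (ContDiff.sum fun j _ =>
      ((hsmooth (hξ j)).comp L.contDiff).mul (P j).contDiff)
  · rw [Fin.sum_univ_castSucc, Fin.sum_univ_castSucc]
    have hc (j : Fin n) : secondPartialC (fun y => F (φ ξ y)) j.castSucc.castSucc x =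
        deriv (deriv F) (φ ξ x) * ξ j (L x) ^ 2 := by
      rw [secondPartialC_comp hF (hφ hξ), hs, congrFun (hd j) x, mul_zero, add_zero]
      rw [hd]
      exact ((hξ j).hasFDerivAt_comp_real L.hasFDerivAt).differentiableAt
    simp only [hc]
    rw [← Finset.mul_sum, hsum,
      secondPartialC_comp hF (hφ hξ) _ _ (by rw [hd₁]; exact hφ hξ' x),
      secondPartialC_comp hF (hφ hξ) _ _ (by rw [hd₂]; exact (hφ hξ' x).mul_const I),
      hs₁, hs₂, congrFun hd₁ x, congrFun hd₂ x, mul_pow, I_sq]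
    ring

/-- Let `m ≥ 3` and let `ξ_1, …, ξ_{m−2} : ℂ → ℂ` be entire functions with
`Σ_j ξ_j(z)² = 0` for all `z`. Define `φ(x) = Σ_j ξ_j(x_{m−1} + i x_m) · x_j`. Then for
every entire `F : ℂ → ℂ`, the composition `F ∘ φ` is harmonic on all of `ℝ^m`. -/
theorem comp_harmonic_morphism_ansatz (m : ℕ) (hm : 3 ≤ m)
    (ξ : Fin (m - 2) → ℂ → ℂ) (hξ : ∀ j, Differentiable ℂ (ξ j))
    (hsum : ∀ z : ℂ, ∑ j : Fin (m - 2), (ξ j z) ^ 2 = 0)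
    (F : ℂ → ℂ) (hF : Differentiable ℂ F) :
    IsHarmonicC (fun x : Fin m → ℝ =>
      F (∑ j : Fin (m - 2),
        ξ j ((x ⟨m - 2, by omega⟩ : ℂ) + (x ⟨m - 1, by omega⟩ : ℂ) * Complex.I) *
          (x ⟨j.1, by have := j.2; omega⟩ : ℂ))) := by
  obtain ⟨n, rfl⟩ : ∃ n, m = n + 2 := ⟨m - 2, by omega⟩
  exact isHarmonicC_comp_sum hξ hsum hF
end

section
/- Let L_1 and L_2 be two distinct parallel affine lines in ℝ², and let L_3 be an affine line that intersects L_1 (and hence L_2) and is not orthogonal to L_1. If f : ℝ² → ℝ is harmonic on all of ℝ² and vanishes at every point of L_1 ∪ L_2 ∪ L_3, then f is identically zero on ℝ². -/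
/-- The real-linear identification of `ℂ` with `ℝ²`. -/
noncomputable def complexToPlane : ℂ →L[ℝ] (Fin 2 → ℝ) :=
  ContinuousLinearMap.pi ![Complex.reCLM, Complex.imCLM]

lemma complexToPlane_zero (z : ℂ) : complexToPlane z 0 = z.re := rfl

lemma complexToPlane_one (z : ℂ) : complexToPlane z 1 = z.im := rfl

lemma complexToPlane_mk (x : Fin 2 → ℝ) : complexToPlane ⟨x 0, x 1⟩ = x := by
  ext i; fin_cases i <;> rfl

lemma iteratedFDeriv_two_comp_continuousLinearMap {E G : Type*}
    [NormedAddCommGroup E] [NormedSpace ℝ E] [NormedAddCommGroup G] [NormedSpace ℝ G]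
    {f : G → ℝ} (hf : ContDiff ℝ 2 f) (L : E →L[ℝ] G) (z u : E) :
    iteratedFDeriv ℝ 2 (f ∘ L) z ![u, u] =
      fderiv ℝ (fun y => fderiv ℝ f y (L u)) (L z) (L u) := by
  have hf' : Differentiable ℝ f := hf.differentiable (by norm_num)
  have hdf : Differentiable ℝ (fderiv ℝ f) :=
    (hf.fderiv_right (m := 1) (by norm_num)).differentiable (by norm_num)
  have hg : ContDiff ℝ 2 (f ∘ L) := hf.comp L.contDiff
  have hdg : Differentiable ℝ (fderiv ℝ (f ∘ L)) :=
    (hg.fderiv_right (m := 1) (by norm_num)).differentiable (by norm_num)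
  have h₁ : fderiv ℝ (fderiv ℝ (f ∘ L)) z u u =
      fderiv ℝ (fun y => fderiv ℝ (f ∘ L) y u) z u := by
    rw [fderiv_clm_apply (hdg z) (differentiableAt_const u)]
    simp
  have h₂ : (fun y => fderiv ℝ (f ∘ L) y u) = (fun y => fderiv ℝ f y (L u)) ∘ L := by
    ext y
    rw [fderiv_comp y (hf' _) L.differentiableAt]
    simp
  have h₃ : Differentiable ℝ (fun y => fderiv ℝ f y (L u)) := by fun_prop
  rw [iteratedFDeriv_two_apply]
  simp only [Matrix.cons_val_zero, Matrix.cons_val_one]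
  rw [h₁, h₂, fderiv_comp z (h₃ _) L.differentiableAt]
  simp

lemma IsHarmonic.harmonicOnNhd_comp_complexToPlane {f : (Fin 2 → ℝ) → ℝ} (hf : IsHarmonic f) :
    InnerProductSpace.HarmonicOnNhd (f ∘ complexToPlane) Set.univ := by
  have hf2 : ContDiff ℝ 2 f := hf.1.of_le (WithTop.coe_le_coe.2 le_top)
  refine fun z _ => ⟨(hf2.comp complexToPlane.contDiff).contDiffAt, .of_forall fun x => ?_⟩
  have h₁ : complexToPlane 1 = Pi.single 0 1 := by
    ext i; fin_cases i <;> simp [complexToPlane_zero, complexToPlane_one]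
  have hI : complexToPlane Complex.I = Pi.single 1 1 := by
    ext i; fin_cases i <;> simp [complexToPlane_zero, complexToPlane_one]
  have hsum := hf.2 (complexToPlane x)
  simp only [Fin.sum_univ_two, secondPartial] at hsum
  rw [InnerProductSpace.laplacian_eq_iteratedFDeriv_complexPlane]
  simp only [iteratedFDeriv_two_comp_continuousLinearMap hf2, h₁, hI]
  exact hsum

/-- Schwarz reflection: an entire function whose real part vanishes on the line `c + ℝ a` has
real part odd with respect to that line. -/
lemma re_reflect_eq_neg {F : ℂ → ℂ} (hF : Differentiable ℂ F) (c a : ℂ)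
    (h : ∀ t : ℝ, (F (c + a * t)).re = 0) (u : ℂ) :
    (F (c + a * star u)).re = -(F (c + a * u)).re := by
  set G : ℂ → ℂ := fun u => F (c + a * u)
  have hG : Differentiable ℂ G := by fun_prop
  have hH : Differentiable ℂ (fun u => -(star (G (star u)))) := fun x =>
    (differentiableAt_conj_conj_iff.2 (hG (star x))).neg
  have hreal : ∀ t : ℝ, G t = -(star (G (star (t : ℂ)))) := fun t => by
    have := h t
    apply Complex.ext <;> simp [G, this]
  have hfreq : ∃ᶠ z in nhdsWithin (0 : ℂ) {0}ᶜ, G z = -(star (G (star z))) := by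
    have ht : Filter.Tendsto (fun t : ℝ => (t : ℂ)) (nhdsWithin 0 {0}ᶜ)
        (nhdsWithin 0 {0}ᶜ) := by
      refine tendsto_nhdsWithin_iff.2 ⟨?_, ?_⟩
      · exact (Complex.continuous_ofReal.tendsto' 0 0 rfl).mono_left nhdsWithin_le_nhds
      · filter_upwards [self_mem_nhdsWithin] with t ht
        simpa using ht
    exact ht.frequently (Filter.Eventually.frequently (.of_forall hreal))
  have hEq := AnalyticOnNhd.eq_of_frequently_eq (fun x _ => hG.analyticAt x)
    (fun x _ => hH.analyticAt x) hfreq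
  have := congrArg Complex.re (congrFun hEq u)
  simp only [Complex.neg_re, Complex.star_def, Complex.conj_re] at this
  simp only [Complex.star_def]
  linarith

lemma isBounded_range_of_two_periods {h : ℂ → ℝ} (hc : Continuous h) {P Q : ℂ} (hP : P ≠ 0)
    (hPQ : (Q / P).im ≠ 0) (hp : Function.Periodic h P) (hq : Function.Periodic h Q) :
    Bornology.IsBounded (Set.range h) := by
  have hK : IsCompact ((fun p : ℝ × ℝ => h (p.1 * P + p.2 * Q)) ''
      (Set.Icc 0 1 ×ˢ Set.Icc 0 1)) :=
    (isCompact_Icc.prod isCompact_Icc).image (by fun_prop)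
  refine hK.isBounded.subset ?_
  rintro _ ⟨u, rfl⟩
  set y : ℝ := (u / P).im / (Q / P).im
  set x : ℝ := (u / P).re - y * (Q / P).re
  have hu : u = x * P + y * Q := by
    have : u / P = x + y * (Q / P) := by
      apply Complex.ext
      · simp only [Complex.add_re, Complex.ofReal_re, Complex.re_ofReal_mul, x]; ring
      · simp only [Complex.add_im, Complex.ofReal_im, Complex.im_ofReal_mul, y]; field_simp; ring
    field_simp at this
    rw [this]; ring
  refine ⟨(Int.fract x, Int.fract y), ⟨⟨Int.fract_nonneg _, (Int.fract_lt_one _).le⟩,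
    ⟨Int.fract_nonneg _, (Int.fract_lt_one _).le⟩⟩, ?_⟩
  have h₁ := hp.sub_zsmul_eq (x := u) ⌊x⌋
  have h₂ := hq.sub_zsmul_eq (x := u - ⌊x⌋ • P) ⌊y⌋
  rw [← h₁, ← h₂]
  simp only [Int.fract, zsmul_eq_mul, Complex.ofReal_sub, Complex.ofReal_intCast]
  congr 1
  linear_combination -hu

/-- The normal form of the three-line theorem: the lines `ℝ`, `k + ℝ` and `ℝ k` in `ℂ`. -/
lemma re_eq_zero_of_vanishing_on_three_lines {F : ℂ → ℂ} (hF : Differentiable ℂ F) {k : ℂ}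
    (hre : k.re ≠ 0) (him : k.im ≠ 0) (h₁ : ∀ t : ℝ, (F t).re = 0)
    (h₂ : ∀ t : ℝ, (F (k + t)).re = 0) (h₃ : ∀ t : ℝ, (F (k * t)).re = 0) (u : ℂ) :
    (F u).re = 0 := by
  have hk : k ≠ 0 := fun h => hre (by simp [h])
  have r₁ := re_reflect_eq_neg hF 0 1 (by simpa using h₁)
  have r₂ := re_reflect_eq_neg hF k 1 (by simpa using h₂)
  have r₃ := re_reflect_eq_neg hF 0 k (by simpa using h₃)
  simp only [zero_add, one_mul] at r₁ r₂ r₃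
  set h : ℂ → ℝ := fun u => (F u).re
  have hp : Function.Periodic h (k - star k) := fun u => by
    have := r₂ (star u - k)
    rw [star_sub, star_star, add_sub_cancel, r₁, neg_neg] at this
    simp only [h]
    rw [← this]
    congr 2; ring
  have hq : Function.Periodic h (k * star ((k - star k) / k)) := fun u => by
    have e₁ := r₃ (star (u / k) + (k - star k) / k)
    have e₂ := r₃ (star (u / k))
    have e₃ := hp (k * star (u / k))
    rw [star_add, star_star, mul_add, mul_add, mul_div_cancel₀ _ hk, mul_div_cancel₀ _ hk] at e₁
    rw [star_star, mul_div_cancel₀ _ hk] at e₂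
    simp only [h] at e₃ ⊢
    rw [e₁, e₂, e₃]
  have hPeq : k - star k = (2 * k.im : ℝ) * Complex.I := by
    simpa using Complex.sub_conj k
  have hP : k - star k ≠ 0 := by
    rw [hPeq]
    simpa using him
  have hPQ : ((k * star ((k - star k) / k)) / (k - star k)).im ≠ 0 := by
    have hs : k * star ((k - star k) / k) / (k - star k) = -(k / star k) := by
      simp only [star_div₀, star_sub, star_star]
      field_simp
      ring
    have hn : Complex.normSq k ≠ 0 := by simpa using hk
    rw [hs, Complex.neg_im, neg_ne_zero, Complex.star_def, Complex.div_im]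
    simp only [Complex.conj_re, Complex.conj_im, Complex.normSq_conj]
    rw [show k.im * k.re / Complex.normSq k - k.re * -k.im / Complex.normSq k =
      2 * (k.re * k.im) / Complex.normSq k by ring]
    exact div_ne_zero (mul_ne_zero two_ne_zero (mul_ne_zero hre him)) hn
  have hharm : InnerProductSpace.HarmonicOnNhd h Set.univ := fun z _ =>
    (hF.analyticAt z).harmonicAt_re
  have hb := isBounded_range_of_two_periods (Complex.continuous_re.comp hF.continuous) hP hPQ hp hq
  have := InnerProductSpace.bounded_harmonic_on_complex_plane_is_constant h hharm hb u (0 : ℝ)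
  exact this.trans (h₁ 0)

/-- Let `L₁`, `L₂` be two distinct parallel affine lines in `ℝ²` (same direction vector
`v ≠ 0`), and let `L₃` be an affine line (direction `w ≠ 0`) intersecting both `L₁` and
`L₂` and not orthogonal to them. Every entire harmonic function on `ℝ²` vanishing on
`L₁ ∪ L₂ ∪ L₃` is identically zero. -/
theorem harmonic_vanishing_on_three_lines_eq_zero
    (p₁ p₂ p₃ v w : Fin 2 → ℝ) (hv : v ≠ 0) (hw : w ≠ 0)
    (L₁ L₂ L₃ : Set (Fin 2 → ℝ))
    (hL₁ : L₁ = {x | ∃ t : ℝ, x = p₁ + t • v})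
    (hL₂ : L₂ = {x | ∃ t : ℝ, x = p₂ + t • v})
    (hL₃ : L₃ = {x | ∃ t : ℝ, x = p₃ + t • w})
    (hne : L₁ ≠ L₂)
    (hint₁ : (L₃ ∩ L₁).Nonempty) (hint₂ : (L₃ ∩ L₂).Nonempty)
    (hnotorth : v 0 * w 0 + v 1 * w 1 ≠ 0)
    (f : (Fin 2 → ℝ) → ℝ) (hf : IsHarmonic f)
    (hzero : ∀ x ∈ L₁ ∪ L₂ ∪ L₃, f x = 0) :
    ∀ x, f x = 0 := by
  subst hL₁ hL₂ hL₃
  obtain ⟨q₁, ⟨s₁, hs₁⟩, ⟨t₁, ht₁⟩⟩ := hint₁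
  obtain ⟨q₂, ⟨s₂, hs₂⟩, ⟨t₂, ht₂⟩⟩ := hint₂
  have hz₁ : ∀ t : ℝ, f (q₁ + t • v) = 0 := fun t =>
    hzero _ (.inl (.inl ⟨t₁ + t, by rw [ht₁]; module⟩))
  have hz₂ : ∀ t : ℝ, f (q₂ + t • v) = 0 := fun t =>
    hzero _ (.inl (.inr ⟨t₂ + t, by rw [ht₂]; module⟩))
  have hz₃ : ∀ t : ℝ, f (q₁ + t • (q₂ - q₁)) = 0 := fun t =>
    hzero _ (.inr ⟨s₁ + t * (s₂ - s₁), by rw [hs₁, hs₂]; module⟩)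
  have hdiff : q₂ - q₁ = (s₂ - s₁) • w := by rw [hs₁, hs₂]; module
  have hnot : ∀ c : ℝ, q₂ - q₁ ≠ c • v := fun c hc => hne <| by
    have hp : p₂ = p₁ + (t₁ + c - t₂) • v := by
      have h₁ : p₁ = q₁ - t₁ • v := by rw [ht₁]; module
      have h₂ : p₂ = q₂ - t₂ • v := by rw [ht₂]; module
      rw [h₁, h₂, ← sub_add_cancel q₂ q₁, hc]; module
    ext x
    constructor
    · rintro ⟨t, rfl⟩
      exact ⟨t - (t₁ + c - t₂), by rw [hp]; module⟩
    · rintro ⟨t, rfl⟩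
      exact ⟨t + (t₁ + c - t₂), by rw [hp]; module⟩
  have hs : s₂ - s₁ ≠ 0 := fun h => hnot 0 (by rw [hdiff, h, zero_smul, zero_smul])
  obtain ⟨F, hF, hFf⟩ :=
    hf.harmonicOnNhd_comp_complexToPlane.exists_analyticOnNhd_univ_re_eq
  have hFf' : ∀ z, (F z).re = f (complexToPlane z) := fun z => congrFun hFf z
  have hFd : Differentiable ℂ F := fun z => (hF z trivial).differentiableAt
  set V : ℂ := ⟨v 0, v 1⟩
  set A : ℂ := ⟨q₁ 0, q₁ 1⟩
  set B : ℂ := ⟨q₂ 0, q₂ 1⟩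
  have hV' : complexToPlane V = v := complexToPlane_mk v
  have hA : complexToPlane A = q₁ := complexToPlane_mk q₁
  have hB : complexToPlane B = q₂ := complexToPlane_mk q₂
  have hV : V ≠ 0 := fun h => hv (by rw [← hV', h, map_zero])
  have hn : Complex.normSq V ≠ 0 := by simpa using hV
  set k : ℂ := (B - A) / V
  have hVk : V * k = B - A := mul_div_cancel₀ _ hV
  have hre : k.re ≠ 0 := by
    have h0 := congrFun hdiff 0
    have h1 := congrFun hdiff 1
    simp only [Pi.sub_apply, Pi.smul_apply, smul_eq_mul] at h0 h1
    have : k.re = (s₂ - s₁) * (v 0 * w 0 + v 1 * w 1) / Complex.normSq V := by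
      simp only [k, Complex.div_re, Complex.sub_re, Complex.sub_im, A, B]
      rw [h0, h1]
      simp only [V]
      ring
    rw [this]
    exact div_ne_zero (mul_ne_zero hs hnotorth) hn
  have him : k.im ≠ 0 := fun h => hnot k.re <| by
    have hk : k = (k.re : ℂ) := Complex.ext rfl (by simpa using h)
    rw [← hA, ← hB, ← hV', ← map_sub, ← hVk, ← map_smul, Complex.real_smul]
    nth_rewrite 1 [hk]
    rw [mul_comm]
  have key := re_eq_zero_of_vanishing_on_three_lines (F := fun u => F (A + V * u))
    (by fun_prop) hre him
    (fun t => by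
      rw [hFf', mul_comm, ← Complex.real_smul, map_add, map_smul, hA, hV']; exact hz₁ t)
    (fun t => by
      rw [mul_add, hVk, ← add_assoc, add_sub_cancel, hFf', mul_comm, ← Complex.real_smul,
        map_add, map_smul, hB, hV']
      exact hz₂ t)
    (fun t => by
      rw [← mul_assoc, hVk, hFf', mul_comm, ← Complex.real_smul, map_add, map_smul, map_sub,
        hA, hB]
      exact hz₃ t)
  intro x
  have := key ((⟨x 0, x 1⟩ - A) / V)
  rwa [mul_div_cancel₀ _ hV, add_sub_cancel, hFf', complexToPlane_mk] at this
end

section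
/- Let W = {x ∈ ℝ³ : x_1 = 0}, let P ⊂ W be a (nondegenerate, bounded) triangle, and let C_P = {x ∈ ℝ³ : x = v + λ e_1, v ∈ P, λ ∈ ℝ} be the corresponding two-sided infinite prism, whose boundary is ∂C_P = {v + λ e_1 : v ∈ ∂P, λ ∈ ℝ}. Suppose that the multiset of interior angles of P is none of the following four: {π/3, π/3, π/3}, {π/6, π/6, 2π/3}, {π/6, π/3, π/2}, {π/4, π/4, π/2}. Then every function f : ℝ³ → ℝ that is harmonic on all of ℝ³ and vanishes at every point of ∂C_P is identically zero. -/
open Real EuclideanGeometry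

/-- The second partial derivative of `f : ℝ³ → ℝ` in the `k`-th coordinate direction. -/
noncomputable def secondPartial3 (f : EuclideanSpace ℝ (Fin 3) → ℝ) (k : Fin 3)
    (x : EuclideanSpace ℝ (Fin 3)) : ℝ :=
  fderiv ℝ (fun y => fderiv ℝ f y (EuclideanSpace.single k 1)) x (EuclideanSpace.single k 1)

/-- A function `f : ℝ³ → ℝ` is harmonic on all of `ℝ³` if it is smooth and its Laplacian
`Σ_{k=1}^3 ∂²f/∂x_k²` vanishes identically. -/
def IsHarmonic3 (f : EuclideanSpace ℝ (Fin 3) → ℝ) : Prop :=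
  ContDiff ℝ (⊤ : ℕ∞) f ∧ ∀ x, ∑ k, secondPartial3 f k x = 0

open MeasureTheory Set Filter Topology
open scoped ContDiff InnerProductSpace ComplexConjugate

lemma hasCompactSupport_of_zero_outside_ball {E : Type*} [NormedAddCommGroup E] [ProperSpace E]
    {φ : E → ℝ} (h : ∀ y, 1 ≤ ‖y‖ → φ y = 0) : HasCompactSupport φ :=
  HasCompactSupport.intro (isCompact_closedBall 0 1) fun y hy => h y (by simp at hy; exact hy.le)

/-- A radial kernel `φ` supported in the unit ball for which `φ y • y` is the gradient of a
function `Ψ` supported in the unit ball. -/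
lemma exists_radial_kernel {E : Type*} [NormedAddCommGroup E] [InnerProductSpace ℝ E]
    [FiniteDimensional ℝ E] [MeasurableSpace E] [BorelSpace E] :
    ∃ φ Ψ : E → ℝ, ContDiff ℝ 1 φ ∧ ContDiff ℝ 1 Ψ ∧ (∀ y, 1 ≤ ‖y‖ → φ y = 0) ∧
      (∀ y, 1 ≤ ‖y‖ → Ψ y = 0) ∧ (∀ y v, fderiv ℝ Ψ y v = φ y * ⟪y, v⟫_ℝ) ∧
      0 < ∫ y, φ y := by
  set g : ℝ → ℝ := fun s => smoothTransition (1 - s) with hg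
  have hgc : ContDiff ℝ 1 g :=
    (smoothTransition.contDiff (n := 1)).comp (contDiff_const.sub contDiff_id)
  have hg0 : ∀ s, 1 ≤ s → g s = 0 := fun s hs => smoothTransition.zero_of_nonpos (by linarith)
  set G : ℝ → ℝ := fun s => ∫ t in (1 : ℝ)..s, g t with hG
  have hGd : ∀ s, HasDerivAt G (g s) s := fun s =>
    intervalIntegral.integral_hasDerivAt_right (hgc.continuous.intervalIntegrable _ _)
      (hgc.continuous.stronglyMeasurableAtFilter _ _) hgc.continuous.continuousAt
  have hGc : ContDiff ℝ 1 G := by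
    rw [contDiff_one_iff_deriv]
    refine ⟨fun s => (hGd s).differentiableAt, ?_⟩
    rw [show deriv G = g from funext fun s => (hGd s).deriv]
    exact hgc.continuous
  have hG0 : ∀ s, 1 ≤ s → G s = 0 := fun s hs => by
    rw [hG]
    refine (intervalIntegral.integral_congr (g := fun _ => 0) fun t ht => ?_).trans (by simp)
    rw [uIcc_of_le hs] at ht
    exact hg0 t ht.1
  have hsq : ∀ y : E, 1 ≤ ‖y‖ → 1 ≤ ‖y‖ ^ 2 := fun y hy => by nlinarith
  have hφc : ContDiff ℝ 1 fun y : E => g (‖y‖ ^ 2) := hgc.comp (contDiff_norm_sq ℝ)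
  refine ⟨fun y => g (‖y‖ ^ 2), fun y => 2⁻¹ * G (‖y‖ ^ 2), hφc,
    contDiff_const.mul (hGc.comp (contDiff_norm_sq ℝ)), fun y hy => hg0 _ (hsq y hy),
    fun y hy => by simp [hG0 _ (hsq y hy)], fun y v => ?_, ?_⟩
  · have h1 : HasFDerivAt (fun y : E => ‖y‖ ^ 2) (2 • innerSL ℝ y) y :=
      (hasStrictFDerivAt_norm_sq y).hasFDerivAt
    have h2 := ((hGd (‖y‖ ^ 2)).comp_hasFDerivAt y h1).const_mul (2⁻¹ : ℝ)
    have h3 : fderiv ℝ (fun y : E => 2⁻¹ * G (‖y‖ ^ 2)) y = _ := h2.fderiv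
    rw [h3]
    simp
    ring
  · refine Continuous.integral_pos_of_hasCompactSupport_nonneg_nonzero (x := 0) hφc.continuous
      (hasCompactSupport_of_zero_outside_ball fun y hy => hg0 _ (hsq y hy))
      (fun y => smoothTransition.nonneg _) ?_
    simp [hg]

/-- The derivative of `f` in the direction `v`. -/
noncomputable def dirDeriv {E : Type*} [NormedAddCommGroup E] [NormedSpace ℝ E] (v : E)
    (f : E → ℝ) : E → ℝ :=
  fun x => fderiv ℝ f x v

section DirDeriv

variable {E : Type*} [NormedAddCommGroup E] [NormedSpace ℝ E] {f g : E → ℝ}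

lemma dirDeriv_contDiff (hf : ContDiff ℝ ∞ f) (v : E) : ContDiff ℝ ∞ (dirDeriv v f) :=
  (hf.fderiv_right (m := ∞) (by simp)).clm_apply contDiff_const

lemma dirDeriv_hasDerivAt (hf : ContDiff ℝ ∞ f) (x v : E) (t : ℝ) :
    HasDerivAt (fun t => f (x + t • v)) (dirDeriv v f (x + t • v)) t := by
  have h1 : HasDerivAt (fun t : ℝ => x + t • v) v t := by
    simpa using ((hasDerivAt_id t).smul_const v).const_add x
  exact ((hf.differentiable (by simp)) _).hasFDerivAt.comp_hasDerivAt t h1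

lemma dirDeriv_dirDeriv (hf : ContDiff ℝ ∞ f) (v w x : E) :
    dirDeriv w (dirDeriv v f) x = fderiv ℝ (fderiv ℝ f) x w v := by
  have h : DifferentiableAt ℝ (fderiv ℝ f) x :=
    ((hf.fderiv_right (m := ∞) (by simp)).differentiable (by simp)) x
  have := h.hasFDerivAt.clm_apply (hasFDerivAt_const v x)
  have h3 : fderiv ℝ (fun y => fderiv ℝ f y v) x = _ := this.fderiv
  unfold dirDeriv
  rw [h3]
  simp

lemma dirDeriv_comm (hf : ContDiff ℝ ∞ f) (v w : E) :
    dirDeriv w (dirDeriv v f) = dirDeriv v (dirDeriv w f) := by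
  ext x
  rw [dirDeriv_dirDeriv hf, dirDeriv_dirDeriv hf]
  exact (hf.contDiffAt.isSymmSndFDerivAt (by
    simpa using (WithTop.coe_le_coe.2 le_top : ((2 : ℕ∞) : WithTop ℕ∞) ≤ ∞))) w v

end DirDeriv

/-- Euclidean three-space. -/
abbrev Space3 := EuclideanSpace ℝ (Fin 3)

lemma isHarmonic3_dirDeriv {u : Space3 → ℝ} (hu : IsHarmonic3 u) (v : Space3) :
    IsHarmonic3 (dirDeriv v u) := by
  refine ⟨dirDeriv_contDiff hu.1 v, fun x => ?_⟩
  have key : ∀ k, secondPartial3 (dirDeriv v u) k =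
      dirDeriv v (secondPartial3 u k) := fun k => by
    change dirDeriv _ (dirDeriv _ (dirDeriv v u)) =
      dirDeriv v (dirDeriv _ (dirDeriv _ u))
    rw [dirDeriv_comm hu.1, dirDeriv_comm (dirDeriv_contDiff hu.1 _)]
  have hd : ∀ k, DifferentiableAt ℝ (secondPartial3 u k) x := fun k =>
    ((dirDeriv_contDiff (dirDeriv_contDiff hu.1 _) _).differentiable (by simp)) x
  simp only [key]
  have h0 : (fun y => ∑ k, secondPartial3 u k y) = fun _ => 0 := funext hu.2
  have := congrArg (fun F => fderiv ℝ F x v) h0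
  simp only [fderiv_fun_sum fun k _ => hd k] at this
  simpa [dirDeriv] using this

lemma apply_eq_sum_inner_mul (y : Space3) (F : Space3 →L[ℝ] ℝ) :
    F y = ∑ k, ⟪y, EuclideanSpace.single k (1 : ℝ)⟫_ℝ * F (EuclideanSpace.single k 1) := by
  conv_lhs => rw [← (EuclideanSpace.basisFun (Fin 3) ℝ).sum_repr y]
  simp [EuclideanSpace.inner_single_right]

lemma fderiv_comp_add_smul {u : Space3 → ℝ} (hu : ContDiff ℝ ∞ u) (x y v : Space3) (r : ℝ) :
    fderiv ℝ (fun y => u (x + r • y)) y v = r * dirDeriv v u (x + r • y) := by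
  have h1 : HasFDerivAt (fun y : Space3 => x + r • y) (r • ContinuousLinearMap.id ℝ Space3) y :=
    ((hasFDerivAt_id y).const_smul r).const_add x
  have h2 := ((hu.differentiable (by simp)) (x + r • y)).hasFDerivAt.comp y h1
  have h3 : fderiv ℝ (fun y => u (x + r • y)) y = _ := h2.fderiv
  rw [h3]
  simp [dirDeriv]

lemma contDiff_comp_add_smul {u : Space3 → ℝ} (hu : ContDiff ℝ ∞ u) (x : Space3) (r : ℝ) :
    ContDiff ℝ ∞ (fun y => u (x + r • y)) :=
  hu.comp (contDiff_const.add (contDiff_id.const_smul r))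

lemma integral_comp_mul_fderiv {u : Space3 → ℝ} (hu : ContDiff ℝ ∞ u) {φ : Space3 → ℝ}
    (hφ : ContDiff ℝ 1 φ) (hφ0 : ∀ y, 1 ≤ ‖y‖ → φ y = 0) (x v : Space3) (r : ℝ) :
    ∫ y, u (x + r • y) * fderiv ℝ φ y v = -(r * ∫ y, dirDeriv v u (x + r • y) * φ y) := by
  have hs := hasCompactSupport_of_zero_outside_ball hφ0
  have hU := contDiff_comp_add_smul hu x r
  have hU' := contDiff_comp_add_smul (dirDeriv_contDiff hu v) x r
  rw [integral_mul_fderiv_eq_neg_fderiv_mul_of_integrable]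
  · simp only [fderiv_comp_add_smul hu, mul_assoc, integral_const_mul]
  · simp only [fderiv_comp_add_smul hu]
    exact ((continuous_const.mul hU'.continuous).mul hφ.continuous).integrable_of_hasCompactSupport
      hs.mul_left
  · refine (hU.continuous.mul
      ((hφ.continuous_fderiv (by simp)).clm_apply
        continuous_const)).integrable_of_hasCompactSupport ?_
    exact (hs.fderiv_apply (𝕜 := ℝ) v).mul_left
  · exact (hU.continuous.mul hφ.continuous).integrable_of_hasCompactSupport hs.mul_left
  · exact fun y _ => (hU.differentiable (by simp)) y
  · exact fun y _ => (hφ.differentiable (by simp)) y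

/-- Mean value property with respect to a radial kernel. -/
lemma IsHarmonic3.integral_comp_mul_kernel {u : Space3 → ℝ} (hu : IsHarmonic3 u)
    {φ Ψ : Space3 → ℝ} (hφ : ContDiff ℝ 1 φ) (hΨ : ContDiff ℝ 1 Ψ)
    (hφ0 : ∀ y, 1 ≤ ‖y‖ → φ y = 0) (hΨ0 : ∀ y, 1 ≤ ‖y‖ → Ψ y = 0)
    (hΨφ : ∀ y v, fderiv ℝ Ψ y v = φ y * ⟪y, v⟫_ℝ) (x : Space3) (r : ℝ) :
    ∫ y, u (x + r • y) * φ y = u x * ∫ y, φ y := by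
  have hs := hasCompactSupport_of_zero_outside_ball hφ0
  have hφi : Integrable φ := hφ.continuous.integrable_of_hasCompactSupport hs
  have hsΨ := hasCompactSupport_of_zero_outside_ball hΨ0
  have hderiv : ∀ r, HasDerivAt (fun r : ℝ => ∫ y, u (x + r • y) * φ y) 0 r := fun r => by
    have hcont : Continuous fun p : ℝ × Space3 => dirDeriv p.2 u (x + p.1 • p.2) := by
      have := hu.1.continuous_fderiv (by simp)
      unfold dirDeriv
      fun_prop
    obtain ⟨M, hM⟩ := ((isCompact_closedBall r 1).prod
      (isCompact_closedBall (0 : Space3) 1)).exists_bound_of_continuousOn hcont.continuousOn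
    have hmain := hasDerivAt_integral_of_dominated_loc_of_deriv_le (μ := volume)
      (F := fun (r : ℝ) (y : Space3) => u (x + r • y) * φ y)
      (F' := fun r y => dirDeriv y u (x + r • y) * φ y) (x₀ := r) (bound := fun y => M * ‖φ y‖)
      (Metric.closedBall_mem_nhds r one_pos)
      (Eventually.of_forall fun s => ((contDiff_comp_add_smul hu.1 x s).continuous.mul
        hφ.continuous).aestronglyMeasurable)
      (((contDiff_comp_add_smul hu.1 x r).continuous.mul
        hφ.continuous).integrable_of_hasCompactSupport hs.mul_left)
      (((hcont.comp (Continuous.prodMk_right r)).mul hφ.continuous).aestronglyMeasurable)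
      (Eventually.of_forall fun y s hsr => ?_) (hφi.norm.const_mul M)
      (Eventually.of_forall fun y s _ => (dirDeriv_hasDerivAt hu.1 x y s).mul_const _)
    · suffices hz : ∫ y, dirDeriv y u (x + r • y) * φ y = 0 by
        have h2 := hmain.2
        rw [hz] at h2
        exact h2
      have hexp : ∀ y, dirDeriv y u (x + r • y) * φ y = ∑ k : Fin 3,
          dirDeriv (EuclideanSpace.single k 1) u (x + r • y) *
            fderiv ℝ Ψ y (EuclideanSpace.single k 1) := fun y => by
        unfold dirDeriv
        rw [apply_eq_sum_inner_mul y, Finset.sum_mul]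
        exact Finset.sum_congr rfl fun k _ => by rw [hΨφ]; ring
      simp only [hexp]
      rw [integral_finsetSum]
      · have hparts := fun k : Fin 3 => integral_comp_mul_fderiv
          (dirDeriv_contDiff hu.1 (EuclideanSpace.single k 1)) hΨ hΨ0 x
            (EuclideanSpace.single k 1) r
        simp only [hparts]
        rw [Finset.sum_neg_distrib, ← Finset.mul_sum, ← integral_finsetSum]
        · simp only [← Finset.sum_mul]
          have h0 : ∀ z, ∑ k : Fin 3, dirDeriv (EuclideanSpace.single k 1)
              (dirDeriv (EuclideanSpace.single k 1) u) z = 0 := hu.2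
          simp [h0]
        · exact fun k _ => ((contDiff_comp_add_smul (dirDeriv_contDiff
            (dirDeriv_contDiff hu.1 _) _) x r).continuous.mul
              hΨ.continuous).integrable_of_hasCompactSupport hsΨ.mul_left
      · exact fun k _ => ((contDiff_comp_add_smul (dirDeriv_contDiff hu.1 _) x r).continuous.mul
          ((hΨ.continuous_fderiv (by simp)).clm_apply
            continuous_const)).integrable_of_hasCompactSupport
              (hsΨ.fderiv_apply (𝕜 := ℝ) _).mul_left
    · rw [norm_mul]
      by_cases hy : 1 ≤ ‖y‖
      · simp [hφ0 y hy]
      · exact mul_le_mul_of_nonneg_right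
          (hM (s, y) ⟨hsr, by simpa using (not_le.1 hy).le⟩) (norm_nonneg _)
  have := is_const_of_deriv_eq_zero (fun r => (hderiv r).differentiableAt)
    (fun r => (hderiv r).deriv) r 0
  rw [this]
  simp [integral_const_mul]

/-- Interior gradient estimate. -/
lemma exists_dirDeriv_le_of_isHarmonic3 (v : Space3) :
    ∃ K : ℝ, 0 ≤ K ∧ ∀ u : Space3 → ℝ, IsHarmonic3 u → ∀ (x : Space3) (r M : ℝ), 0 < r →
      (∀ y, ‖y - x‖ ≤ r → |u y| ≤ M) → |dirDeriv v u x| ≤ K / r * M := by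
  obtain ⟨φ, Ψ, hφ, hΨ, hφ0, hΨ0, hΨφ, hpos⟩ := exists_radial_kernel (E := Space3)
  have hs := hasCompactSupport_of_zero_outside_ball hφ0
  have hsv := hs.fderiv_apply (𝕜 := ℝ) v
  have hcv : Continuous fun y => fderiv ℝ φ y v :=
    (hφ.continuous_fderiv (by simp)).clm_apply continuous_const
  have hiv := hcv.integrable_of_hasCompactSupport (μ := volume) hsv
  refine ⟨(∫ y, |fderiv ℝ φ y v|) / ∫ y, φ y,
    div_nonneg (integral_nonneg fun _ => abs_nonneg _) hpos.le, fun u hu x r M hr hM => ?_⟩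
  have h1 := (isHarmonic3_dirDeriv hu v).integral_comp_mul_kernel hφ hΨ hφ0 hΨ0 hΨφ x r
  have h2 := integral_comp_mul_fderiv hu.1 hφ hφ0 x v r
  rw [h1] at h2
  have h3 : |∫ y, u (x + r • y) * fderiv ℝ φ y v| ≤ ∫ y, M * |fderiv ℝ φ y v| := by
    refine (abs_integral_le_integral_abs).trans (integral_mono_of_nonneg
      (Eventually.of_forall fun y => abs_nonneg _) (hiv.abs.const_mul M)
      (Eventually.of_forall fun y => ?_))
    simp only [abs_mul]
    by_cases hy : ‖y‖ ≤ 1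
    · refine mul_le_mul_of_nonneg_right (hM _ ?_) (abs_nonneg _)
      rw [add_sub_cancel_left, norm_smul, Real.norm_of_nonneg hr.le]
      nlinarith
    · have : fderiv ℝ φ y v = 0 := by
        have : φ =ᶠ[𝓝 y] fun _ => 0 := by
          filter_upwards [(isOpen_lt continuous_const continuous_norm).mem_nhds (not_le.1 hy)]
            with z hz using hφ0 z (le_of_lt hz)
        rw [this.fderiv_eq]
        simp
      simp [this]
  rw [h2, abs_neg, abs_mul, abs_mul, abs_of_pos hr, abs_of_pos hpos, integral_const_mul] at h3
  calc |dirDeriv v u x| = (r * (|dirDeriv v u x| * ∫ y, φ y)) / (r * ∫ y, φ y) := by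
        field_simp
    _ ≤ (M * ∫ y, |fderiv ℝ φ y v|) / (r * ∫ y, φ y) := by gcongr
    _ = _ := by field_simp

lemma isHarmonic3_iterate_dirDeriv {u : Space3 → ℝ} (hu : IsHarmonic3 u) (v : Space3) (k : ℕ) :
    IsHarmonic3 ((dirDeriv v)^[k] u) := by
  induction k with
  | zero => exact hu
  | succ k ih =>
    rw [Function.iterate_succ_apply']
    exact isHarmonic3_dirDeriv ih v

/-- Analytic bounds for the iterated directional derivatives of a harmonic function. -/
lemma exists_iterate_dirDeriv_le {u : Space3 → ℝ} (hu : IsHarmonic3 u) (x v : Space3) {t : ℝ}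
    (ht : 0 ≤ t) :
    ∃ M q : ℝ, 0 ≤ q ∧ q < 1 ∧ ∀ k : ℕ, 1 ≤ k → ∀ s, |s| ≤ t →
      |(dirDeriv v)^[k] u (x + s • v)| * (t ^ k / k.factorial) ≤ M * q ^ k := by
  obtain ⟨K, hK, hest⟩ := exists_dirDeriv_le_of_isHarmonic3 v
  have hiter : ∀ (r M : ℝ), 0 < r → ∀ (k : ℕ) (x : Space3),
      (∀ y, ‖y - x‖ ≤ k * r → |u y| ≤ M) → |(dirDeriv v)^[k] u x| ≤ (K / r) ^ k * M := by
    intro r M hr k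
    induction k with
    | zero => intro x h; simpa using h x (by simp)
    | succ k ih =>
      intro x h
      rw [Function.iterate_succ_apply', pow_succ', mul_assoc]
      refine hest _ (isHarmonic3_iterate_dirDeriv hu v k) x r _ hr fun y hy => ih y fun z hz =>
        h z ?_
      calc ‖z - x‖ ≤ ‖z - y‖ + ‖y - x‖ := norm_sub_le_norm_sub_add_norm_sub _ _ _
        _ ≤ k * r + r := add_le_add hz hy
        _ = _ := by push_cast; ring
  set R : ℝ := 2 * (K * t * rexp 1) + 1 with hRdef
  have hp : 0 ≤ K * t * rexp 1 := by positivity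
  have hR : 0 < R := by positivity
  obtain ⟨M, hM⟩ := (isCompact_closedBall x (t * ‖v‖ + R)).exists_bound_of_continuousOn
    hu.1.continuous.continuousOn
  have hM0 : 0 ≤ M := (norm_nonneg _).trans (hM x (by simp; positivity))
  refine ⟨M, K * t * rexp 1 / R, by positivity, by rw [div_lt_one hR]; linarith,
    fun k hk s hs => ?_⟩
  have hk0 : (0 : ℝ) < k := by exact_mod_cast hk
  have h1 := hiter (R / k) M (by positivity) k (x + s • v) fun y hy => hM y ?_
  · have h2 := Real.pow_div_factorial_le_exp (x := k) hk0.le k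
    calc |(dirDeriv v)^[k] u (x + s • v)| * (t ^ k / k.factorial)
        ≤ ((K / (R / k)) ^ k * M) * (t ^ k / k.factorial) := by gcongr
      _ = M * (K * t / R) ^ k * ((k : ℝ) ^ k / k.factorial) := by
        rw [show K / (R / k) = K / R * k by field_simp, mul_div_right_comm K t R]
        simp only [mul_pow]
        ring
      _ ≤ M * (K * t / R) ^ k * rexp k := by gcongr
      _ = M * (K * t * rexp 1 / R) ^ k := by
        rw [show (k : ℝ) = k * 1 by ring, Real.exp_nat_mul, mul_assoc, ← mul_pow]
        congr 2
        ring
  · rw [mem_closedBall_iff_norm]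
    have h3 : (k : ℝ) * (R / k) = R := by field_simp
    rw [h3] at hy
    calc ‖y - x‖ = ‖(y - (x + s • v)) + s • v‖ := by congr 1; abel
      _ ≤ R + |s| * ‖v‖ := (norm_add_le _ _).trans (add_le_add hy (norm_smul _ _).le)
      _ ≤ t * ‖v‖ + R := by nlinarith [norm_nonneg v]

lemma abs_le_of_derivs_eq_zero {g : ℕ → ℝ → ℝ} (hg : ∀ k t, HasDerivAt (g k) (g (k + 1) t) t)
    (h0 : ∀ k, g k 0 = 0) {t B : ℝ} (n : ℕ) (hB : ∀ s ∈ Icc 0 t, |g n s| ≤ B) :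
    ∀ s ∈ Icc 0 t, |g 0 s| ≤ B * (s ^ n / n.factorial) := by
  induction n generalizing g with
  | zero => simpa using hB
  | succ n ih =>
    have h1 := ih (g := fun k => g (k + 1)) (fun k => hg (k + 1)) (fun k => h0 (k + 1)) hB
    have hfence := image_norm_le_of_norm_deriv_right_le_deriv_boundary (a := 0) (b := t)
      (f := g 0) (f' := g 1) (B := fun s => B * (s ^ (n + 1) / (n + 1).factorial))
      (B' := fun s => B * (s ^ n / n.factorial))
      (fun s _ => (hg 0 s).continuousAt.continuousWithinAt)
      (fun s _ => (hg 0 s).hasDerivWithinAt) (by simp [h0]) (fun s => ?_)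
      (fun s hs => h1 s (Ico_subset_Icc_self hs))
    · exact fun s hs => hfence hs
    · refine (((hasDerivAt_pow (n + 1) s).div_const ((n + 1).factorial : ℝ)).const_mul
        B).congr_deriv ?_
      rw [Nat.factorial_succ]
      push_cast
      have : (n.factorial : ℝ) ≠ 0 := by positivity
      field_simp

lemma eq_zero_of_analytic_bound {g : ℕ → ℝ → ℝ} (hg : ∀ k t, HasDerivAt (g k) (g (k + 1) t) t)
    (h0 : ∀ k, g k 0 = 0) {t M q : ℝ} (ht : 0 ≤ t) (hq : 0 ≤ q) (hq1 : q < 1)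
    (hb : ∀ k : ℕ, 1 ≤ k → ∀ s ∈ Icc 0 t, |g k s| * (t ^ k / k.factorial) ≤ M * q ^ k) :
    g 0 t = 0 := by
  rcases ht.eq_or_lt with rfl | ht
  · exact h0 0
  have hle : ∀ᶠ k : ℕ in atTop, |g 0 t| ≤ M * q ^ k := by
    filter_upwards [eventually_ge_atTop 1] with k hk
    have hpos : 0 < t ^ k / k.factorial := by positivity
    have := abs_le_of_derivs_eq_zero hg h0 (t := t) (B := M * q ^ k / (t ^ k / k.factorial)) k
      (fun s hs => (le_div_iff₀ hpos).2 (hb k hk s hs)) t ⟨ht.le, le_rfl⟩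
    rwa [div_mul_cancel₀ _ hpos.ne'] at this
  have hlim : Tendsto (fun k : ℕ => M * q ^ k) atTop (𝓝 0) := by
    simpa using (tendsto_pow_atTop_nhds_zero_of_lt_one hq hq1).const_mul M
  exact abs_nonpos_iff.1 (ge_of_tendsto hlim hle)

lemma iterate_dirDeriv_hasDerivAt {u : Space3 → ℝ} (hu : IsHarmonic3 u) (x v : Space3) (k : ℕ)
    (t : ℝ) : HasDerivAt (fun t => (dirDeriv v)^[k] u (x + t • v))
      ((dirDeriv v)^[k + 1] u (x + t • v)) t := by
  rw [Function.iterate_succ_apply']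
  exact dirDeriv_hasDerivAt (isHarmonic3_iterate_dirDeriv hu v k).1 x v t

/-- A harmonic function vanishing on a segment vanishes on the line through it. -/
lemma IsHarmonic3.eq_zero_on_line {u : Space3 → ℝ} (hu : IsHarmonic3 u) {x v : Space3} {a b : ℝ}
    (hab : a < b) (h : ∀ s ∈ Ioo a b, u (x + s • v) = 0) (t : ℝ) : u (x + t • v) = 0 := by
  obtain ⟨c, hc⟩ := nonempty_Ioo.2 hab
  obtain ⟨y, hy⟩ : ∃ y, y = x + c • v := ⟨_, rfl⟩
  have hray : ∀ v : Space3, (∀ᶠ s in 𝓝 (0 : ℝ), u (y + s • v) = 0) → ∀ t : ℝ, 0 ≤ t →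
      u (y + t • v) = 0 := by
    intro v hv t ht
    have hk : ∀ k, ∀ᶠ s in 𝓝 (0 : ℝ), (dirDeriv v)^[k] u (y + s • v) = 0 := by
      intro k
      induction k with
      | zero => exact hv
      | succ k ih =>
        have h1 : (fun s : ℝ => (dirDeriv v)^[k] u (y + s • v)) =ᶠ[𝓝 0] fun _ => 0 := ih
        filter_upwards [h1.deriv] with s hs
        rwa [(iterate_dirDeriv_hasDerivAt hu y v k s).deriv, deriv_const] at hs
    obtain ⟨M, q, hq, hq1, hb⟩ := exists_iterate_dirDeriv_le hu y v ht
    exact eq_zero_of_analytic_bound (iterate_dirDeriv_hasDerivAt hu y v)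
      (fun k => (hk k).self_of_nhds) ht hq hq1
      fun k hk s hs => hb k hk s (by rw [abs_of_nonneg hs.1]; exact hs.2)
  have hev : ∀ᶠ s in 𝓝 (0 : ℝ), u (y + s • v) = 0 := by
    have hcont : Tendsto (fun s : ℝ => c + s) (𝓝 0) (𝓝 c) :=
      Continuous.tendsto' (by fun_prop) _ _ (by simp)
    filter_upwards [hcont.eventually (isOpen_Ioo.mem_nhds hc)] with s hs
    rw [hy, add_assoc, ← add_smul]
    exact h _ hs
  have hev' : ∀ᶠ s in 𝓝 (0 : ℝ), u (y + s • -v) = 0 := by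
    have hcont : Tendsto (fun s : ℝ => -s) (𝓝 0) (𝓝 0) :=
      Continuous.tendsto' (by fun_prop) _ _ (by simp)
    filter_upwards [hcont.eventually hev] with s hs
    simpa using hs
  rcases le_total c t with hct | hct
  · have := hray v hev (t - c) (by linarith)
    rwa [hy, add_assoc, ← add_smul, add_sub_cancel] at this
  · have := hray (-v) hev' (c - t) (by linarith)
    rwa [hy, smul_neg, ← neg_smul, add_assoc, ← add_smul, neg_sub, add_sub_cancel] at this

/-- The point of `ℝ³` with first coordinate `s` and remaining coordinates given by `z`. -/
def slicePoint (s : ℝ) (z : ℂ) : Space3 := !₂[s, z.re, z.im]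

lemma slicePoint_add (s s' : ℝ) (z z' : ℂ) :
    slicePoint (s + s') (z + z') = slicePoint s z + slicePoint s' z' := by
  ext i; fin_cases i <;> simp [slicePoint]

lemma slicePoint_add_smul (s : ℝ) (z w : ℂ) (t : ℝ) :
    slicePoint s (z + t * w) = slicePoint s z + t • slicePoint 0 w := by
  ext i; fin_cases i <;> simp [slicePoint]

lemma slicePoint_add_smul_single (s t : ℝ) (z : ℂ) :
    slicePoint (s + t) z = slicePoint s z + t • EuclideanSpace.single (0 : Fin 3) (1 : ℝ) := by
  ext i; fin_cases i <;> simp [slicePoint]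

lemma slicePoint_zero_eq (w : ℂ) : slicePoint 0 w =
    w.re • EuclideanSpace.single (1 : Fin 3) (1 : ℝ) +
      w.im • EuclideanSpace.single (2 : Fin 3) (1 : ℝ) := by
  ext i; fin_cases i <;> simp [slicePoint]

lemma slicePoint_coord (x : Space3) : slicePoint (x 0) ⟨x 1, x 2⟩ = x := by
  ext i; fin_cases i <;> simp [slicePoint]

lemma continuous_slicePoint (s : ℝ) : Continuous (slicePoint s) := by
  unfold slicePoint
  refine (PiLp.continuous_toLp 2 _).comp (continuous_pi fun i => ?_)
  fin_cases i
  · exact continuous_const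
  · exact Complex.continuous_re
  · exact Complex.continuous_im

/-- The Laplace equation in a rotated orthonormal frame. -/
lemma IsHarmonic3.rotated_frame {u : Space3 → ℝ} (hu : IsHarmonic3 u) {w : ℂ}
    (hw : Complex.normSq w = 1) (x : Space3) :
    dirDeriv (slicePoint 0 (Complex.I * w)) (dirDeriv (slicePoint 0 (Complex.I * w)) u) x =
      -(dirDeriv (EuclideanSpace.single 0 1) (dirDeriv (EuclideanSpace.single 0 1) u) x +
        dirDeriv (slicePoint 0 w) (dirDeriv (slicePoint 0 w) u) x) := by
  have h := hu.2 x
  change ∑ k : Fin 3, dirDeriv (EuclideanSpace.single k 1)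
    (dirDeriv (EuclideanSpace.single k 1) u) x = 0 at h
  rw [Fin.sum_univ_three] at h
  simp only [dirDeriv_dirDeriv hu.1] at h ⊢
  simp only [slicePoint_zero_eq, map_add, map_smul, add_apply,
    smul_apply, smul_eq_mul, Complex.mul_re, Complex.mul_im, Complex.I_re, Complex.I_im]
  rw [Complex.normSq_apply] at hw
  linear_combination h + (fderiv ℝ (fderiv ℝ u) x (EuclideanSpace.single 1 1)
    (EuclideanSpace.single 1 1) + fderiv ℝ (fderiv ℝ u) x (EuclideanSpace.single 2 1)
    (EuclideanSpace.single 2 1)) * hw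

/-- Schwarz reflection: a harmonic function vanishing on a plane is odd about it. -/
lemma IsHarmonic3.odd_of_eq_zero_on_plane {u : Space3 → ℝ} (hu : IsHarmonic3 u) {a w : ℂ}
    (hw : Complex.normSq w = 1) (h : ∀ s t : ℝ, u (slicePoint s (a + t * w)) = 0) (s : ℝ)
    (ζ : ℂ) : u (slicePoint s (a + ζ * w)) = -u (slicePoint s (a + conj ζ * w)) := by
  set n := slicePoint 0 (Complex.I * w) with hn
  have hstep : ∀ u : Space3 → ℝ, IsHarmonic3 u → (∀ s t : ℝ, u (slicePoint s (a + t * w)) = 0) →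
      ∀ s t : ℝ, dirDeriv n (dirDeriv n u) (slicePoint s (a + t * w)) = 0 := by
    intro u hu h
    have h0 : ∀ u : Space3 → ℝ, IsHarmonic3 u →
        (∀ s t : ℝ, u (slicePoint s (a + t * w)) = 0) →
        ∀ s t : ℝ, dirDeriv (EuclideanSpace.single 0 1) u (slicePoint s (a + t * w)) = 0 := by
      intro u hu h s t
      have h1 := dirDeriv_hasDerivAt hu.1 (slicePoint s (a + t * w)) (EuclideanSpace.single 0 1) 0
      simp only [← slicePoint_add_smul_single, h, add_zero] at h1
      exact h1.unique (hasDerivAt_const _ _)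
    have h1 : ∀ u : Space3 → ℝ, IsHarmonic3 u →
        (∀ s t : ℝ, u (slicePoint s (a + t * w)) = 0) →
        ∀ s t : ℝ, dirDeriv (slicePoint 0 w) u (slicePoint s (a + t * w)) = 0 := by
      intro u hu h s t
      have h1 := dirDeriv_hasDerivAt hu.1 (slicePoint s (a + t * w)) (slicePoint 0 w) 0
      simp only [← slicePoint_add_smul, add_assoc, ← add_mul, ← Complex.ofReal_add, h,
        add_zero] at h1
      exact h1.unique (hasDerivAt_const _ _)
    intro s t
    rw [hu.rotated_frame hw, h0 _ (isHarmonic3_dirDeriv hu _) (h0 u hu h),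
      h1 _ (isHarmonic3_dirDeriv hu _) (h1 u hu h)]
    simp
  have heven : ∀ k s t, (dirDeriv n)^[2 * k] u (slicePoint s (a + (t : ℝ) * w)) = 0 := by
    intro k
    induction k with
    | zero => exact h
    | succ k ih =>
      intro s t
      rw [show 2 * (k + 1) = 2 * k + 1 + 1 by ring, Function.iterate_succ_apply',
        Function.iterate_succ_apply']
      exact hstep _ (isHarmonic3_iterate_dirDeriv hu n _) ih s t
  have hpos : ∀ t r : ℝ, 0 ≤ r → u (slicePoint s (a + t * w) + r • n) +
      u (slicePoint s (a + t * w) + (-r) • n) = 0 := by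
    intro t r hr
    set y := slicePoint s (a + t * w)
    obtain ⟨M, q, hq, hq1, hb⟩ := exists_iterate_dirDeriv_le hu y n hr
    have := eq_zero_of_analytic_bound (g := fun k r => (dirDeriv n)^[k] u (y + r • n) +
      (-1) ^ k * (dirDeriv n)^[k] u (y + (-r) • n)) (t := r) (M := 2 * M) (q := q)
      (fun k r => ?_) (fun k => ?_) hr hq hq1 (fun k hk r' hr' => ?_)
    · simpa using this
    · have h1 := (iterate_dirDeriv_hasDerivAt hu y n k (-r)).scomp r (hasDerivAt_neg r)
      refine ((iterate_dirDeriv_hasDerivAt hu y n k r).add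
        (h1.const_mul ((-1) ^ k))).congr_deriv ?_
      simp [pow_succ]
    · rcases Nat.even_or_odd' k with ⟨m, rfl | rfl⟩
      · simp [heven m s t, y]
      · simp [pow_succ, pow_mul]
    · have h1 := hb k hk r' (by rw [abs_of_nonneg hr'.1]; exact hr'.2)
      have h2 := hb k hk (-r') (by rw [abs_neg, abs_of_nonneg hr'.1]; exact hr'.2)
      have h3 : |(dirDeriv n)^[k] u (y + r' • n) + (-1) ^ k * (dirDeriv n)^[k] u (y + (-r') • n)| ≤
          |(dirDeriv n)^[k] u (y + r' • n)| + |(dirDeriv n)^[k] u (y + (-r') • n)| := by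
        refine (abs_add_le _ _).trans (le_of_eq ?_)
        simp [abs_mul]
      calc _ ≤ (|(dirDeriv n)^[k] u (y + r' • n)| + |(dirDeriv n)^[k] u (y + (-r') • n)|) *
            (r ^ k / k.factorial) := by gcongr
        _ ≤ 2 * M * q ^ k := by linarith
  have hpt : ∀ ζ : ℂ, slicePoint s (a + ζ * w) = slicePoint s (a + ζ.re * w) + ζ.im • n := by
    intro ζ
    rw [hn, ← slicePoint_add_smul, ← mul_assoc, add_assoc, ← add_mul, Complex.re_add_im]
  rw [hpt, hpt (conj ζ), Complex.conj_re, Complex.conj_im]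
  rcases le_total 0 ζ.im with hi | hi
  · linarith [hpos ζ.re ζ.im hi]
  · have := hpos ζ.re (-ζ.im) (by linarith)
    rw [neg_neg] at this
    linarith

/-- The additive group of periods of a function. -/
def periodSubgroup (F : ℂ → ℝ) : AddSubgroup ℂ where
  carrier := {v | ∀ z, F (z + v) = F z}
  zero_mem' := by simp
  add_mem' := by
    intro v w hv hw z
    rw [← add_assoc, hw, hv]
  neg_mem' := by
    intro v hv z
    rw [← hv (z + -v), neg_add_cancel_right]

lemma mul_conj_eq_one {w : ℂ} (hw : Complex.normSq w = 1) : w * conj w = 1 := by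
  rw [Complex.mul_conj, hw, Complex.ofReal_one]

section Planar

variable {F : ℂ → ℝ}

/-- The composition of two reflections in lines through `a` is a rotation. -/
lemma rotation_invariant_of_odd {a w₁ w₂ : ℂ} (h₁ : Complex.normSq w₁ = 1)
    (h₂ : Complex.normSq w₂ = 1) (ho₁ : ∀ ζ, F (a + ζ * w₁) = -F (a + conj ζ * w₁))
    (ho₂ : ∀ ζ, F (a + ζ * w₂) = -F (a + conj ζ * w₂)) (z : ℂ) :
    F (a + (w₂ * conj w₁) ^ 2 * (z - a)) = F z := by
  have e₁ := mul_conj_eq_one h₁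
  have e₂ := mul_conj_eq_one h₂
  have r₁ := ho₁ (conj w₁ * (z - a))
  have r₂ := ho₂ (conj w₂ * (w₁ ^ 2 * conj (z - a)))
  rw [show a + conj w₁ * (z - a) * w₁ = z by linear_combination (z - a) * e₁] at r₁
  rw [show a + conj w₂ * (w₁ ^ 2 * conj (z - a)) * w₂ = a + conj (conj w₁ * (z - a)) * w₁ by
    simp only [map_mul, Complex.conj_conj]
    linear_combination (w₁ ^ 2 * conj (z - a)) * e₂] at r₂
  rw [r₁, r₂, neg_neg]
  congr 1
  simp only [map_mul, Complex.conj_conj, map_pow]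
  ring

lemma conj_rotation_invariant {a ρ : ℂ} (hρ : ρ * conj ρ = 1)
    (h : ∀ z, F (a + ρ * (z - a)) = F z) (z : ℂ) : F (a + conj ρ * (z - a)) = F z := by
  rw [← h (a + conj ρ * (z - a))]
  congr 1
  linear_combination (z - a) * hρ

lemma mul_mem_periodSubgroup {a ρ : ℂ} (hρ : ρ * conj ρ = 1)
    (h : ∀ z, F (a + ρ * (z - a)) = F z) {v : ℂ} (hv : v ∈ periodSubgroup F) :
    ρ * v ∈ periodSubgroup F := by
  intro z
  have h1 := h (a + conj ρ * (z - a) + v)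
  rw [hv, conj_rotation_invariant hρ h] at h1
  rw [← h1]
  congr 1
  linear_combination (a - z) * hρ

/-- The commutator of two rotations is a translation. -/
lemma commutator_mem_periodSubgroup {a b ρ σ : ℂ} (hρ : ρ ≠ 0) (hσ : σ ≠ 0)
    (ha : ∀ z, F (a + ρ * (z - a)) = F z) (hb : ∀ z, F (b + σ * (z - b)) = F z) :
    (a - b) * (1 - ρ) * (1 - σ) ∈ periodSubgroup F := by
  intro z
  obtain ⟨y, hy⟩ : ∃ y, z = b + σ * (a + ρ * (y - a) - b) :=
    ⟨a + ((z - b) / σ + b - a) / ρ, by field_simp; ring⟩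
  have h1 : F (a + ρ * (b + σ * (y - b) - a)) = F y := by rw [ha, hb]
  have h2 : F z = F y := by rw [hy, hb, ha]
  rw [h2, ← h1, hy]
  congr 1
  ring

/-- Crystallographic restriction. -/
lemma exists_small_mem_of_rotation {T : AddSubgroup ℂ} {ρ : ℂ}
    (hT : ∀ v ∈ T, ρ * v ∈ T) (hT' : ∀ v ∈ T, conj ρ * v ∈ T) (hint : ∀ m : ℤ, 2 * ρ.re ≠ m)
    {v : ℂ} (hv : v ∈ T) (hv0 : v ≠ 0) {ε : ℝ} (hε : 0 < ε) : ∃ v ∈ T, v ≠ 0 ∧ ‖v‖ < ε := by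
  set δ : ℝ := 2 * ρ.re - round (2 * ρ.re) with hδ
  have hδ0 : (δ : ℂ) ≠ 0 := by
    rw [Complex.ofReal_ne_zero, hδ, sub_ne_zero]
    exact hint _
  have hδ1 : |δ| < 1 := (abs_sub_round _).trans_lt (by norm_num)
  have hmem : ∀ n : ℕ, (δ : ℂ) ^ n * v ∈ T := by
    intro n
    induction n with
    | zero => simpa using hv
    | succ n ih =>
      have h1 := T.sub_mem (T.add_mem (hT _ ih) (hT' _ ih)) (T.zsmul_mem ih (round (2 * ρ.re)))
      convert h1 using 1
      rw [zsmul_eq_mul, ← add_mul, Complex.add_conj, hδ]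
      push_cast
      ring
  have hlim : Tendsto (fun n : ℕ => |δ| ^ n * ‖v‖) atTop (𝓝 0) := by
    simpa using (tendsto_pow_atTop_nhds_zero_of_lt_one (abs_nonneg δ) hδ1).mul_const ‖v‖
  obtain ⟨n, hn⟩ := (hlim.eventually (gt_mem_nhds hε)).exists
  exact ⟨_, hmem n, mul_ne_zero (pow_ne_zero n hδ0) hv0, by simpa using hn⟩

lemma eq_zero_of_odd_real {a w : ℂ} (ho : ∀ ζ, F (a + ζ * w) = -F (a + conj ζ * w)) (t : ℝ) :
    F (a + t * w) = 0 := by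
  have := ho t
  rw [Complex.conj_ofReal] at this
  linarith

lemma exists_near_zero {a w v : ℂ} (hw : Complex.normSq w = 1)
    (hz : ∀ t : ℝ, F (a + t * w) = 0) (hv : v ∈ periodSubgroup F) (hne : (conj w * v).im ≠ 0)
    (z : ℂ) : ∃ z', F z' = 0 ∧ ‖z' - z‖ ≤ ‖v‖ := by
  set q := (conj w * v).im with hq
  set p := (conj w * (z - a)).im with hp
  set k := round (p / q) with hk
  have e := mul_conj_eq_one hw
  have hwn : ‖w‖ = 1 := by
    rw [← Complex.sq_norm] at hw
    exact (pow_eq_one_iff_of_nonneg (norm_nonneg w) two_ne_zero).1 hw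
  set r : ℝ := p - k * q with hr
  have hrq : |r| ≤ ‖v‖ := by
    have h1 : r = (p / q - k) * q := by rw [hr]; field_simp
    have h2 : |q| ≤ ‖v‖ := (Complex.abs_im_le_norm _).trans (by simp [hwn])
    rw [h1, abs_mul]
    have h3 := abs_sub_round (p / q)
    have h4 := abs_nonneg q
    nlinarith
  refine ⟨z - r * Complex.I * w, ?_, ?_⟩
  · have hkv := (periodSubgroup F).neg_mem ((periodSubgroup F).zsmul_mem hv k)
    rw [← hkv, ← hz (conj w * (z - r * Complex.I * w + -(k • v) - a)).re]
    congr 1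
    set y := conj w * (z - r * Complex.I * w + -(k • v) - a) with hy
    have him : y.im = 0 := by
      have : y = conj w * (z - a) - k * (conj w * v) - r * Complex.I := by
        rw [hy, zsmul_eq_mul]
        linear_combination (-(r : ℂ) * Complex.I) * e
      rw [this]
      simp [← hp, ← hq, hr]
    have hyre : (y.re : ℂ) = y := Complex.ext (by simp) (by simp [him])
    rw [hyre, hy]
    linear_combination (-(z - r * Complex.I * w + -(k • v) - a)) * e
  · simpa [hwn] using hrq

/-- A continuous planar function that is odd about two lines through `a` and about two lines
through `b` vanishes if the angle at `a` violates the crystallographic restriction. -/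
lemma eq_zero_of_odd_about_lines (hF : Continuous F) {a b w₁ w₂ w₃ w₄ : ℂ} (hab : a ≠ b)
    (h₁ : Complex.normSq w₁ = 1) (h₂ : Complex.normSq w₂ = 1) (h₃ : Complex.normSq w₃ = 1)
    (h₄ : Complex.normSq w₄ = 1) (ho₁ : ∀ ζ, F (a + ζ * w₁) = -F (a + conj ζ * w₁))
    (ho₂ : ∀ ζ, F (a + ζ * w₂) = -F (a + conj ζ * w₂))
    (ho₃ : ∀ ζ, F (b + ζ * w₃) = -F (b + conj ζ * w₃))
    (ho₄ : ∀ ζ, F (b + ζ * w₄) = -F (b + conj ζ * w₄))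
    (hint : ∀ m : ℤ, 2 * ((w₂ * conj w₁) ^ 2).re ≠ m) (hσ : (w₄ * conj w₃) ^ 2 ≠ 1) (z : ℂ) :
    F z = 0 := by
  have hrot : ∀ {w w' : ℂ}, Complex.normSq w = 1 → Complex.normSq w' = 1 →
      (w * conj w') ^ 2 * conj ((w * conj w') ^ 2) = 1 := fun hw hw' =>
    mul_conj_eq_one (by simp [hw, hw'])
  have e₁ := mul_conj_eq_one h₁
  have hinv := rotation_invariant_of_odd h₁ h₂ ho₁ ho₂
  have hinv' := rotation_invariant_of_odd h₃ h₄ ho₃ ho₄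
  have hρ := hrot h₂ h₁
  have hσ' := hrot h₄ h₃
  set ρ := (w₂ * conj w₁) ^ 2 with hρdef
  set σ := (w₄ * conj w₃) ^ 2
  have hρ1 : ρ ≠ 1 := fun h => hint 2 (by simp [h])
  have hmem := commutator_mem_periodSubgroup (left_ne_zero_of_mul_eq_one hρ)
    (left_ne_zero_of_mul_eq_one hσ') hinv hinv'
  have hne : (a - b) * (1 - ρ) * (1 - σ) ≠ 0 :=
    mul_ne_zero (mul_ne_zero (sub_ne_zero.2 hab) (sub_ne_zero.2 hρ1.symm))
      (sub_ne_zero.2 hσ.symm)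
  suffices h : z ∈ closure {z | F z = 0} by
    rwa [(isClosed_eq hF continuous_const).closure_eq] at h
  rw [Metric.mem_closure_iff]
  intro ε hε
  obtain ⟨v, hv, hv0, hvε⟩ := exists_small_mem_of_rotation
    (fun v => mul_mem_periodSubgroup hρ hinv)
    (fun v => mul_mem_periodSubgroup (ρ := conj ρ) (by rw [Complex.conj_conj, mul_comm, hρ])
      (conj_rotation_invariant hρ hinv)) hint hmem hne hε
  have hcase : (conj w₁ * v).im ≠ 0 ∨ (conj w₂ * v).im ≠ 0 := by
    by_contra! hcon
    have hreal : ∀ w : ℂ, (conj w * v).im = 0 → conj w * v = w * conj v := fun w hw => by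
      have := Complex.conj_eq_iff_im.2 hw
      simpa using this.symm
    have hr1 := hreal _ hcon.1
    have hr2 := hreal _ hcon.2
    apply hρ1
    have e₂ := mul_conj_eq_one h₂
    have hvc : v = w₁ ^ 2 * conj v := by linear_combination w₁ * hr1 - v * e₁
    have hvc' : v = w₂ ^ 2 * conj v := by linear_combination w₂ * hr2 - v * e₂
    have hv0' : conj v ≠ 0 := by simpa using hv0
    have hsq : w₁ ^ 2 = w₂ ^ 2 := mul_right_cancel₀ hv0' (hvc.symm.trans hvc')
    rw [hρdef, mul_pow, ← hsq]
    linear_combination (w₁ * conj w₁ + 1) * e₁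
  obtain ⟨z', hz', hd⟩ : ∃ z', F z' = 0 ∧ ‖z' - z‖ ≤ ‖v‖ := by
    rcases hcase with h | h
    · exact exists_near_zero h₁ (eq_zero_of_odd_real ho₁) hv h z
    · exact exists_near_zero h₂ (eq_zero_of_odd_real ho₂) hv h z
  exact ⟨z', hz', by rw [dist_comm, dist_eq_norm]; exact hd.trans_lt hvε⟩

end Planar

/-- The orthogonal projection of `ℝ³` onto the last two coordinates, as a complex number. -/
def planarPart (x : Space3) : ℂ := ⟨x 1, x 2⟩

lemma slicePoint_planarPart {x : Space3} (hx : x 0 = 0) : slicePoint 0 (planarPart x) = x := by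
  rw [← hx]
  exact slicePoint_coord x

/-- The unit direction from `A` to `B`, as a complex number. -/
noncomputable def planarDir (A B : Space3) : ℂ :=
  (planarPart B - planarPart A) / ‖planarPart B - planarPart A‖

lemma planarPart_ne {A B : Space3} (hA : A 0 = 0) (hB : B 0 = 0) (hAB : A ≠ B) :
    planarPart A ≠ planarPart B := fun h =>
  hAB (by rw [← slicePoint_planarPart hA, ← slicePoint_planarPart hB, h])

lemma normSq_planarDir {A B : Space3} (hA : A 0 = 0) (hB : B 0 = 0) (hAB : A ≠ B) :
    Complex.normSq (planarDir A B) = 1 := by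
  have : ‖planarPart B - planarPart A‖ ≠ 0 :=
    norm_ne_zero_iff.2 (sub_ne_zero.2 (planarPart_ne hA hB hAB).symm)
  rw [Complex.normSq_eq_norm_sq]
  simp [planarDir, this]

lemma odd_about_side {u : Space3 → ℝ} (hu : IsHarmonic3 u) {A B : Space3} (hA : A 0 = 0)
    (hB : B 0 = 0) (hAB : A ≠ B)
    (hz : ∀ v ∈ segment ℝ A B, ∀ lam : ℝ,
      u (v + lam • EuclideanSpace.single (0 : Fin 3) (1 : ℝ)) = 0) (s : ℝ) (ζ : ℂ) :
    u (slicePoint s (planarPart A + ζ * planarDir A B)) =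
      -u (slicePoint s (planarPart A + conj ζ * planarDir A B)) := by
  refine hu.odd_of_eq_zero_on_plane (normSq_planarDir hA hB hAB) (fun s t => ?_) s ζ
  have hn : (‖planarPart B - planarPart A‖ : ℂ) ≠ 0 := by
    exact_mod_cast norm_ne_zero_iff.2 (sub_ne_zero.2 (planarPart_ne hA hB hAB).symm)
  have hline := hu.eq_zero_on_line (x := slicePoint s (planarPart A))
    (v := slicePoint 0 (planarPart B - planarPart A)) zero_lt_one (fun τ hτ => ?_)
    (t / ‖planarPart B - planarPart A‖)
  · rw [← slicePoint_add_smul] at hline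
    rw [← hline, planarDir]
    congr 3
    push_cast
    field_simp
  · rw [← slicePoint_add_smul, ← zero_add s, slicePoint_add_smul_single]
    refine hz _ ?_ s
    rw [segment_eq_image']
    refine ⟨τ, Ioo_subset_Icc_self hτ, ?_⟩
    have h1 : B - A = slicePoint 0 (planarPart B - planarPart A) := by
      rw [sub_eq_iff_eq_add, ← slicePoint_planarPart hA, ← slicePoint_planarPart hB,
        ← slicePoint_add]
      simp [slicePoint_planarPart hA, slicePoint_planarPart hB]
    simp only [h1]
    rw [slicePoint_add_smul, slicePoint_planarPart hA]

lemma two_mul_re_sq_planarDir {A B C : Space3} (hA : A 0 = 0) (hB : B 0 = 0) (hC : C 0 = 0)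
    (hAB : A ≠ B) (hAC : A ≠ C) :
    2 * ((planarDir A C * conj (planarDir A B)) ^ 2).re = 4 * Real.cos (∠ B A C) ^ 2 - 2 := by
  have hcos : (planarDir A C * conj (planarDir A B)).re = Real.cos (∠ B A C) := by
    rw [EuclideanGeometry.angle, InnerProductGeometry.cos_angle]
    simp [planarDir, planarPart, EuclideanSpace.norm_eq, Fin.sum_univ_three, PiLp.inner_apply,
      hA, hB, hC, Complex.norm_def, Complex.normSq_apply]
    simp only [← pow_two]
    ring
  have hn : Complex.normSq (planarDir A C * conj (planarDir A B)) = 1 := by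
    simp [normSq_planarDir hA hC hAC, normSq_planarDir hA hB hAB]
  rw [← hcos]
  rw [Complex.normSq_apply] at hn
  rw [pow_two, Complex.mul_re]
  linear_combination -2 * hn

lemma cos_sq_ne_one_of_not_collinear {A B C : Space3}
    (hnc : ¬ Collinear ℝ ({A, B, C} : Set Space3)) : Real.cos (∠ B A C) ^ 2 ≠ 1 := by
  intro h
  have hnc' : ¬ Collinear ℝ ({B, A, C} : Set Space3) := by rwa [Set.insert_comm]
  rw [collinear_iff_eq_or_eq_or_angle_eq_zero_or_angle_eq_pi] at hnc'
  push Not at hnc'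
  have hs : Real.sin (∠ B A C) = 0 := by
    have := Real.sin_sq_add_cos_sq (∠ B A C)
    nlinarith
  have hpos := Real.sin_pos_of_pos_of_lt_pi
    (lt_of_le_of_ne (EuclideanGeometry.angle_nonneg B A C) hnc'.2.2.1.symm)
    (lt_of_le_of_ne (EuclideanGeometry.angle_le_pi B A C) hnc'.2.2.2)
  exact hpos.ne' hs

/-- The crystallographic restriction for the angle at the vertex `A`. -/
lemma exists_int_eq_of_harmonic_ne_zero {A B C : Space3} (hA : A 0 = 0) (hB : B 0 = 0)
    (hC : C 0 = 0) (hnc : ¬ Collinear ℝ ({A, B, C} : Set Space3)) {f : Space3 → ℝ}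
    (hf : IsHarmonic3 f)
    (hzero : ∀ v ∈ segment ℝ A B ∪ segment ℝ B C ∪ segment ℝ C A, ∀ lam : ℝ,
      f (v + lam • EuclideanSpace.single (0 : Fin 3) (1 : ℝ)) = 0) {x : Space3} (hx : f x ≠ 0) :
    ∃ m : ℤ, 4 * Real.cos (∠ B A C) ^ 2 - 2 = m := by
  by_contra! hint
  apply hx
  have hAB : A ≠ B := ne₁₂_of_not_collinear hnc
  have hAC : A ≠ C := ne₁₃_of_not_collinear hnc
  have hBC : B ≠ C := ne₂₃_of_not_collinear hnc
  have zAB := fun v hv => hzero v (Or.inl (Or.inl hv))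
  have zBC := fun v hv => hzero v (Or.inl (Or.inr hv))
  have zCA := fun v hv => hzero v (Or.inr hv)
  have h := eq_zero_of_odd_about_lines (F := fun z => f (slicePoint (x 0) z))
    (hf.1.continuous.comp (continuous_slicePoint _)) (planarPart_ne hA hB hAB)
    (normSq_planarDir hA hB hAB) (normSq_planarDir hA hC hAC)
    (normSq_planarDir hB hA hAB.symm) (normSq_planarDir hB hC hBC)
    (odd_about_side hf hA hB hAB zAB _)
    (odd_about_side hf hA hC hAC (by rwa [segment_symm]) _)
    (odd_about_side hf hB hA hAB.symm (by rwa [segment_symm]) _)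
    (odd_about_side hf hB hC hBC zBC _)
    (by rwa [two_mul_re_sq_planarDir hA hB hC hAB hAC]) ?_ (planarPart x)
  · simpa [planarPart, slicePoint_coord] using h
  · intro h1
    have h2 := two_mul_re_sq_planarDir hB hA hC hAB.symm hBC
    rw [h1, Complex.one_re] at h2
    refine cos_sq_ne_one_of_not_collinear (A := B) (B := A) (C := C) ?_ (by linarith)
    rwa [Set.insert_comm]

lemma exists_nat_mul_pi_div_twelve_of_cos_sq {θ : ℝ} (h0 : 0 ≤ θ) (hπ : θ ≤ π) {m : ℤ}
    (hm : 4 * Real.cos θ ^ 2 - 2 = m) (h1 : Real.cos θ ^ 2 ≠ 1) :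
    ∃ n ∈ ({2, 3, 4, 6, 8, 9, 10} : Finset ℕ), θ = n * (π / 12) := by
  have hle : Real.cos θ ^ 2 < 1 := lt_of_le_of_ne (Real.cos_sq_le_one θ) h1
  have hmlo : -2 ≤ m := by
    have : (-2 : ℝ) ≤ m := by nlinarith [sq_nonneg (Real.cos θ)]
    exact_mod_cast this
  have hmhi : m < 2 := by
    have : (m : ℝ) < 2 := by linarith
    exact_mod_cast this
  have key : ∀ n ∈ ({2, 3, 4, 6, 8, 9, 10} : Finset ℕ), ∀ φ : ℝ, φ = n * (π / 12) →
      Real.cos θ = Real.cos φ →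
      ∃ n ∈ ({2, 3, 4, 6, 8, 9, 10} : Finset ℕ), θ = n * (π / 12) := by
    intro n hn φ hφ hc
    refine ⟨n, hn, ?_⟩
    have hn12 : (n : ℝ) ≤ 12 := by
      have : n ≤ 12 := by fin_cases hn <;> norm_num
      exact_mod_cast this
    rw [← hφ]
    refine Real.injOn_cos ⟨h0, hπ⟩ ⟨?_, ?_⟩ hc
    · rw [hφ]; positivity
    · rw [hφ]; nlinarith [Real.pi_pos]
  have hsplit : ∀ c : ℝ, Real.cos θ ^ 2 = c ^ 2 → Real.cos θ = c ∨ Real.cos θ = -c :=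
    fun c hc => sq_eq_sq_iff_eq_or_eq_neg.1 hc
  have h2 : √2 ^ 2 = (2 : ℝ) := Real.sq_sqrt (by norm_num)
  have h3 : √3 ^ 2 = (3 : ℝ) := Real.sq_sqrt (by norm_num)
  interval_cases m
  · have hc : Real.cos θ = 0 := by
      have : Real.cos θ ^ 2 = 0 := by push_cast at hm; linarith
      simpa using this
    exact key 6 (by decide) (π / 2) (by push_cast; ring) (by rw [hc, Real.cos_pi_div_two])
  · rcases hsplit (1 / 2) (by push_cast at hm; linarith) with hc | hc
    · exact key 4 (by decide) (π / 3) (by push_cast; ring) (by rw [hc, Real.cos_pi_div_three])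
    · exact key 8 (by decide) (π - π / 3) (by push_cast; ring)
        (by rw [hc, Real.cos_pi_sub, Real.cos_pi_div_three])
  · rcases hsplit (√2 / 2) (by push_cast at hm; linarith) with hc | hc
    · exact key 3 (by decide) (π / 4) (by push_cast; ring) (by rw [hc, Real.cos_pi_div_four])
    · exact key 9 (by decide) (π - π / 4) (by push_cast; ring)
        (by rw [hc, Real.cos_pi_sub, Real.cos_pi_div_four])
  · rcases hsplit (√3 / 2) (by push_cast at hm; linarith) with hc | hc
    · exact key 2 (by decide) (π / 6) (by push_cast; ring) (by rw [hc, Real.cos_pi_div_six])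
    · exact key 10 (by decide) (π - π / 6) (by push_cast; ring)
        (by rw [hc, Real.cos_pi_sub, Real.cos_pi_div_six])

lemma multiset_eq_of_sum_eq_twelve :
    ∀ a ∈ ({2, 3, 4, 6, 8, 9, 10} : Finset ℕ), ∀ b ∈ ({2, 3, 4, 6, 8, 9, 10} : Finset ℕ),
      ∀ c ∈ ({2, 3, 4, 6, 8, 9, 10} : Finset ℕ), a + b + c = 12 →
        ({a, b, c} : Multiset ℕ) = {4, 4, 4} ∨ ({a, b, c} : Multiset ℕ) = {2, 2, 8} ∨
        ({a, b, c} : Multiset ℕ) = {2, 4, 6} ∨ ({a, b, c} : Multiset ℕ) = {3, 3, 6} := by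
  decide

/-- Let `P ⊂ W = {x₁ = 0}` be a nondegenerate triangle with vertices `A, B, C` whose
multiset of interior angles is none of `{π/3,π/3,π/3}`, `{π/6,π/6,2π/3}`,
`{π/6,π/3,π/2}`, `{π/4,π/4,π/2}`. Then every entire harmonic function on `ℝ³` vanishing
on the boundary `∂C_P = {v + λe₁ : v ∈ ∂P, λ ∈ ℝ}` of the two-sided infinite prism over
`P` is identically zero. -/
theorem harmonic_vanishing_on_prism_boundary_eq_zero
    (A B C : EuclideanSpace ℝ (Fin 3))
    (hA : A 0 = 0) (hB : B 0 = 0) (hC : C 0 = 0)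
    (hnc : ¬ Collinear ℝ ({A, B, C} : Set (EuclideanSpace ℝ (Fin 3))))
    (hangles : ({∠ B A C, ∠ A B C, ∠ A C B} : Multiset ℝ) ∉
      ({{π / 3, π / 3, π / 3}, {π / 6, π / 6, 2 * π / 3},
        {π / 6, π / 3, π / 2}, {π / 4, π / 4, π / 2}} : Set (Multiset ℝ)))
    (f : EuclideanSpace ℝ (Fin 3) → ℝ) (hf : IsHarmonic3 f)
    (hzero : ∀ v ∈ segment ℝ A B ∪ segment ℝ B C ∪ segment ℝ C A, ∀ lam : ℝ,
      f (v + lam • EuclideanSpace.single (0 : Fin 3) (1 : ℝ)) = 0) :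
    ∀ x, f x = 0 := by
  by_contra! hne
  obtain ⟨x, hx⟩ := hne
  have hncB : ¬ Collinear ℝ ({B, A, C} : Set Space3) := by rwa [Set.insert_comm]
  have hncC : ¬ Collinear ℝ ({C, A, B} : Set Space3) := by
    rwa [Set.insert_comm, Set.pair_comm C B]
  obtain ⟨m₁, hm₁⟩ := exists_int_eq_of_harmonic_ne_zero hA hB hC hnc hf hzero hx
  obtain ⟨m₂, hm₂⟩ := exists_int_eq_of_harmonic_ne_zero hB hA hC hncB hf (fun v hv => hzero v (by
    rw [segment_symm ℝ B A, segment_symm ℝ A C, segment_symm ℝ C B] at hv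
    simp only [mem_union] at hv ⊢
    tauto)) hx
  obtain ⟨m₃, hm₃⟩ := exists_int_eq_of_harmonic_ne_zero hC hA hB hncC hf (fun v hv => hzero v (by
    simp only [mem_union] at hv ⊢
    tauto)) hx
  obtain ⟨a, ha, hθa⟩ := exists_nat_mul_pi_div_twelve_of_cos_sq (EuclideanGeometry.angle_nonneg _ _ _)
    (EuclideanGeometry.angle_le_pi _ _ _) hm₁ (cos_sq_ne_one_of_not_collinear hnc)
  obtain ⟨b, hb, hθb⟩ := exists_nat_mul_pi_div_twelve_of_cos_sq (EuclideanGeometry.angle_nonneg _ _ _)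
    (EuclideanGeometry.angle_le_pi _ _ _) hm₂ (cos_sq_ne_one_of_not_collinear hncB)
  obtain ⟨c, hc, hθc⟩ := exists_nat_mul_pi_div_twelve_of_cos_sq (EuclideanGeometry.angle_nonneg _ _ _)
    (EuclideanGeometry.angle_le_pi _ _ _) hm₃ (cos_sq_ne_one_of_not_collinear hncC)
  have hsum := EuclideanGeometry.angle_add_angle_add_angle_eq_pi (p₁ := B) (p₂ := A) C
    (ne₁₂_of_not_collinear hnc)
  rw [EuclideanGeometry.angle_comm C B A, hθa, hθb, hθc] at hsum
  have habc : a + b + c = 12 := by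
    have : (a + b + c : ℝ) = 12 := by
      have := Real.pi_pos
      field_simp at hsum
      linarith
    exact_mod_cast this
  have hmap : ({∠ B A C, ∠ A B C, ∠ A C B} : Multiset ℝ) =
      ({a, b, c} : Multiset ℕ).map fun n => n * (π / 12) := by
    simp [hθa, hθb, hθc]
  apply hangles
  rw [hmap]
  simp only [mem_insert_iff, mem_singleton_iff]
  rcases multiset_eq_of_sum_eq_twelve a ha b hb c hc habc with h | h | h | h <;> rw [h]
  · left
    simp
    ring_nf
  · right; left
    simp
    ring_nf
  · right; right; left
    simp
    ring_nf
  · right; right; right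
    simp
    ring_nf
end
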